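/- arXiv:1602.07330 — 5 statements merged into one kernel-verified Lean document; each statement's English description precedes it below -/
import Mathlib

section
/- Let n ≥ 1 and let f ∈ ℝ[X₁,…,Xₙ] be a positive semidefinite polynomial of even total degree d, and let F ∈ ℝ[X₀,X₁,…,Xₙ] be its degree-d homogenization. Then F(x₀,x₁,…,xₙ) ≥ 0 for every (x₀,x₁,…,xₙ) ∈ ℝ^{n+1}. -/
/-- Scaling for evaluations of homogeneous polynomials. -/
theorem eval_smul_of_isHomogeneous {m d : ℕ} {F : MvPolynomial (Fin m) ℝ}
    (hF : F.IsHomogeneous d) (r : ℝ) (x : Fin m → ℝ) :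
    MvPolynomial.eval (fun i => r * x i) F = r ^ d * MvPolynomial.eval x F := by
  rw [MvPolynomial.eval_eq, MvPolynomial.eval_eq, Finset.mul_sum]
  refine Finset.sum_congr rfl fun s hs => ?_
  have h := hF.degree_eq_sum_deg_support hs
  simp only [mul_pow, Finset.prod_mul_distrib, Finset.prod_pow_eq_pow_sum]
  rw [h]
  ring

/-- The degree-`d` homogenization of a positive semidefinite polynomial of even
total degree `d` is nonnegative on all of `ℝ^{n+1}`. -/
theorem homogenization_nonneg
    (n : ℕ) (hn : 1 ≤ n)
    (f : MvPolynomial (Fin n) ℝ)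
    (hpsd : ∀ x : Fin n → ℝ, 0 ≤ MvPolynomial.eval x f)
    (heven : Even f.totalDegree)
    (F : MvPolynomial (Fin (n + 1)) ℝ)
    (hFhom : F.IsHomogeneous f.totalDegree)
    (hFf : MvPolynomial.aeval
        (Fin.cases (1 : MvPolynomial (Fin n) ℝ) MvPolynomial.X) F = f) :
    ∀ x : Fin (n + 1) → ℝ, 0 ≤ MvPolynomial.eval x F := by
  have key : ∀ y : Fin n → ℝ,
      MvPolynomial.eval y f = MvPolynomial.eval (Fin.cons 1 y : Fin (n + 1) → ℝ) F := by
    intro y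
    have h := congrArg (MvPolynomial.eval y) hFf
    rw [← h, MvPolynomial.aeval_def, MvPolynomial.eval₂_comp_left (MvPolynomial.eval y)]
    rw [MvPolynomial.eval, MvPolynomial.coe_eval₂Hom]
    congr 1
    · ext r
      simp
    · funext i
      refine Fin.cases ?_ (fun j => ?_) i <;> simp
  have hne : ∀ x : Fin (n + 1) → ℝ, x 0 ≠ 0 → 0 ≤ MvPolynomial.eval x F := by
    intro x hx
    have h1 : x = fun i => x 0 * (Fin.cons 1 (fun j : Fin n => x j.succ / x 0) :
        Fin (n + 1) → ℝ) i := by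
      funext i
      refine Fin.cases ?_ (fun j => ?_) i
      · simp
      · simp only [Fin.cons_succ]
        field_simp
    rw [h1, eval_smul_of_isHomogeneous hFhom, ← key]
    exact mul_nonneg (heven.pow_nonneg _) (hpsd _)
  intro x
  by_cases hx : x 0 = 0
  · have hc : Continuous fun t : ℝ => MvPolynomial.eval (Function.update x 0 t) F :=
      (MvPolynomial.continuous_eval F).comp (continuous_const.update 0 continuous_id)
    have hd : Dense ({0}ᶜ : Set ℝ) := dense_compl_singleton 0
    have hcl : IsClosed {t : ℝ | 0 ≤ MvPolynomial.eval (Function.update x 0 t) F} :=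
      isClosed_le continuous_const hc
    have hsub : ({0}ᶜ : Set ℝ) ⊆ {t : ℝ | 0 ≤ MvPolynomial.eval (Function.update x 0 t) F} := by
      intro t ht
      exact hne _ (by simpa using ht)
    have h0 := hcl.closure_subset_iff.2 hsub (hd 0)
    have hu : Function.update x 0 0 = x := by
      conv_rhs => rw [← Function.update_eq_self 0 x, hx]
    simpa [hu] using h0
  · exact hne x hx
end

section
/- Let n ≥ 0, d ≥ 1, and let F ∈ ℝ[X₀,…,Xₙ] be homogeneous of degree d with F(y) ≥ 0 for every y ∈ ℝ^{n+1}. If for every x ∈ ℝ^{n+1} ∖ {0} at least one partial derivative ∂F/∂Xᵢ does not vanish at x, then F(x) > 0 for every x ∈ ℝ^{n+1} ∖ {0}. (That is, a nonnegative form whose real zero locus away from the origin is smooth is positive definite.) -/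
theorem hasDerivAt_eval_update {σ : Type*} [DecidableEq σ] (F : MvPolynomial σ ℝ)
    (x : σ → ℝ) (i : σ) :
    HasDerivAt (fun t : ℝ => MvPolynomial.eval (Function.update x i t) F)
      (MvPolynomial.eval x (MvPolynomial.pderiv i F)) (x i) := by
  induction F using MvPolynomial.induction_on with
  | C a => simpa using hasDerivAt_const (x i) a
  | add p q hp hq => simpa using hp.fun_add hq
  | mul_X p j hp =>
    have hX : HasDerivAt (fun t : ℝ => Function.update x i t j)
        (MvPolynomial.eval x (MvPolynomial.pderiv i (MvPolynomial.X j))) (x i) := by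
      by_cases h : j = i
      · subst h
        simpa using hasDerivAt_id' (x j)
      · simpa [h, MvPolynomial.pderiv_X_of_ne h] using hasDerivAt_const (x i) (x j)
    have := hp.fun_mul hX
    rw [MvPolynomial.pderiv_mul]
    simpa using this

/-- A nonnegative real form whose real zero locus away from the origin is smooth
is positive definite: if `F` is homogeneous of degree `d ≥ 1`, nonnegative on
`ℝ^{n+1}`, and at every `x ≠ 0` some partial derivative of `F` does not vanish,
then `F(x) > 0` for every `x ≠ 0`. -/
theorem nonneg_smooth_form_posdef
    (n d : ℕ) (hd : 1 ≤ d)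
    (F : MvPolynomial (Fin (n + 1)) ℝ)
    (hFhom : F.IsHomogeneous d)
    (hFnonneg : ∀ y : Fin (n + 1) → ℝ, 0 ≤ MvPolynomial.eval y F)
    (hFsmooth : ∀ x : Fin (n + 1) → ℝ, x ≠ 0 →
      ∃ i : Fin (n + 1), MvPolynomial.eval x (MvPolynomial.pderiv i F) ≠ 0) :
    ∀ x : Fin (n + 1) → ℝ, x ≠ 0 → 0 < MvPolynomial.eval x F := by
  intro x hx
  refine lt_of_le_of_ne (hFnonneg x) fun h0 => ?_
  obtain ⟨i, hi⟩ := hFsmooth x hx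
  apply hi
  have hmin : IsLocalMin
      (fun t : ℝ => MvPolynomial.eval (Function.update x i t) F) (x i) := by
    refine Filter.Eventually.of_forall fun t => ?_
    simp only [Function.update_eq_self]
    rw [← h0]
    exact hFnonneg _
  exact hmin.hasDerivAt_eq_zero (hasDerivAt_eval_update F x i)
end

section
/- Let K be a field, Γ₀ a linearly ordered commutative group with zero, and v : K → Γ₀ a valuation. Let 𝒪 := {x ∈ K : v(x) ≤ 1} be its valuation ring and k its residue field, and assume that k is formally real, i.e., −1 is not a sum of squares in k. Let h₁,…,h_m ∈ K and set g := h₁² + ⋯ + h_m². If v(g) = 1, then v(hᵢ) ≤ 1 for every i (so all hᵢ lie in 𝒪), and the residue of g in k equals the sum of the squares of the residues of the hᵢ; in particular the residue of g is a sum of m squares in k. -/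
/-- (Specialization of sums of squares.) Let `v` be a valuation on a field `K`
whose residue field is formally real, let `h₁, …, h_m ∈ K` and
`g = h₁² + ⋯ + h_m²`. If `v g = 1`, then all `hᵢ` lie in the valuation ring of
`v`, and the residue of `g` is the sum of the squares of the residues of the
`hᵢ`. -/
theorem valuation_residue_sum_of_squares
    {K : Type*} [Field K] {Γ₀ : Type*} [LinearOrderedCommGroupWithZero Γ₀]
    (v : Valuation K Γ₀)
    (hreal : ¬ IsSumSq (-1 : IsLocalRing.ResidueField v.integer))
    (m : ℕ) (h : Fin m → K) (g : K) (hg : g = ∑ i, h i ^ 2)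
    (hvg : v g = 1) :
    ∃ hmem : ∀ i, h i ∈ v.integer,
      IsLocalRing.residue v.integer ⟨g, (v.mem_integer_iff g).mpr hvg.le⟩
        = ∑ i, (IsLocalRing.residue v.integer ⟨h i, hmem i⟩) ^ 2 := by
  have hmem : ∀ i, h i ∈ v.integer := by
    by_contra hcon
    push Not at hcon
    obtain ⟨i₀, hi₀⟩ := hcon
    rw [v.mem_integer_iff, not_le] at hi₀
    obtain ⟨j, -, hj⟩ := Finset.exists_max_image Finset.univ (fun i => v (h i))
      ⟨i₀, Finset.mem_univ _⟩
    have hj1 : 1 < v (h j) := hi₀.trans_le (hj i₀ (Finset.mem_univ _))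
    have hv0 : 0 < v (h j) := zero_lt_one.trans hj1
    have hc : h j ≠ 0 := by
      intro h0
      simp [h0] at hv0
    have ha : ∀ i, h i / h j ∈ v.integer := by
      intro i
      rw [v.mem_integer_iff, map_div₀]
      exact (div_le_one₀ hv0).mpr (hj i (Finset.mem_univ _))
    let a : Fin m → v.integer := fun i => ⟨h i / h j, ha i⟩
    have haj : a j = 1 := Subtype.ext (div_self hc)
    have hsum : ((∑ i, a i ^ 2 : v.integer) : K) = g / h j ^ 2 := by
      push_cast
      rw [hg, Finset.sum_div]
      exact Finset.sum_congr rfl fun i _ => div_pow _ _ _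
    have hlt : v ((∑ i, a i ^ 2 : v.integer) : K) < 1 := by
      rw [hsum, map_div₀, hvg, map_pow]
      exact (div_lt_one₀ (pow_pos hv0 2)).mpr (one_lt_pow₀ hj1 two_ne_zero)
    have hz : IsLocalRing.residue v.integer (∑ i, a i ^ 2) = 0 := by
      rw [IsLocalRing.residue_eq_zero_iff, IsLocalRing.mem_maximalIdeal, mem_nonunits_iff]
      intro hu
      obtain ⟨y, hy⟩ := hu.exists_right_inv
      have h1 := congrArg (fun z : v.integer => v (z : K)) hy
      have hy1 : v (y : K) ≤ 1 := y.2
      simp only [Subring.coe_mul, map_mul, Subring.coe_one, map_one] at h1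
      exact absurd h1 (mul_lt_one_of_lt_of_le hlt hy1).ne
    rw [map_sum, ← Finset.add_sum_erase _ _ (Finset.mem_univ j), haj] at hz
    simp only [map_pow, map_one, one_pow] at hz
    apply hreal
    rw [neg_eq_of_add_eq_zero_right hz]
    exact IsSumSq.sum_sq _ _
  refine ⟨hmem, ?_⟩
  simp only [← map_pow, ← map_sum]
  congr 1
  apply Subtype.ext
  push_cast
  exact hg
end

section
/- Let X be a nonempty integral scheme locally of finite type over Spec ℝ. Then the following are equivalent: (i) the function field ℝ(X) of X is formally real, i.e., −1 is not a sum of squares in ℝ(X); (ii) the set of ℝ-rational points of X (points x ∈ X whose residue field is ℝ, i.e., such that the structure map ℝ → κ(x) is an isomorphism) is dense in X. -/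
namespace ArtinLang
open Polynomial

section realclosure

lemma sumSq_map {A B : Type*} [CommRing A] [CommRing B] (φ : A →+* B) {x : A} (h : IsSumSq x) :
    IsSumSq (φ x) := by
  induction h with
  | zero => rw [map_zero]; exact .zero
  | sq_add a hs ih => rw [map_add, map_mul]; exact .sq_add _ ih

/-- In a semireal field sums of squares adding to zero vanish -/
lemma sumSq_eq_zero {R : Type*} [Field R] [IsSemireal R] {a b : R} (ha : IsSumSq a) (hb : IsSumSq b)
    (h : a + b = 0) : a = 0 := by
  by_contra hne
  have h1 : b = -a := by linear_combination h
  have h2 : (-1 : R) = b * a * (a⁻¹ * a⁻¹) := by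
    rw [h1]; field_simp
  exact IsSemireal.not_isSumSq_neg_one R (h2 ▸ (hb.mul ha).mul (IsSumSq.mul_self _))

lemma poly_sumSq {R : Type*} [Field R] [IsSemireal R] {q : R[X]} (hq : IsSumSq q) :
    Even q.natDegree ∧ IsSumSq q.leadingCoeff := by
  induction hq with
  | zero => simp
  | @sq_add a s hs ih =>
    obtain ⟨ih1, ih2⟩ := ih
    by_cases ha : a = 0
    · subst ha; simpa using ⟨ih1, ih2⟩
    have hd : (a * a).natDegree = a.natDegree + a.natDegree := natDegree_mul ha ha
    have hl : (a * a).leadingCoeff = a.leadingCoeff * a.leadingCoeff := leadingCoeff_mul _ _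
    have hls : IsSumSq (a * a).leadingCoeff := hl ▸ IsSumSq.mul_self _
    have haa : a * a ≠ 0 := mul_ne_zero ha ha
    by_cases hs0 : s = 0
    · subst hs0; rw [add_zero]; exact ⟨⟨_, hd⟩, hls⟩
    rcases lt_trichotomy (a * a).degree s.degree with h | h | h
    · rw [natDegree_add_eq_right_of_degree_lt h, leadingCoeff_add_of_degree_lt h]
      exact ⟨ih1, ih2⟩
    · have hne : (a * a).leadingCoeff + s.leadingCoeff ≠ 0 := by
        intro h0
        exact leadingCoeff_ne_zero.mpr haa (sumSq_eq_zero hls ih2 h0)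
      have hdeg : (a * a + s).degree = (a*a).degree := by
        rw [degree_add_eq_of_leadingCoeff_add_ne_zero hne, h, max_self]
      rw [natDegree_eq_of_degree_eq hdeg, leadingCoeff_add_of_degree_eq h hne]
      exact ⟨⟨_, hd⟩, hls.add ih2⟩
    · rw [natDegree_add_eq_left_of_degree_lt h, leadingCoeff_add_of_degree_lt' h]
      exact ⟨⟨_, hd⟩, hls⟩

variable {R Ω : Type*} [Field R] [Field Ω] [Algebra R Ω] [IsAlgClosed Ω] [IsSemireal R]

open IntermediateField in
lemma sq_or_aux (hmax : ∀ y : Ω, y ∉ Set.range (algebraMap R Ω) → IsSumSq (-1 : R⟮y⟯))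
    (a : R) (ha : ¬ IsSquare a) : IsSumSq (-a) := by
  obtain ⟨y, hy⟩ := IsAlgClosed.exists_pow_nat_eq (algebraMap R Ω a) (n := 2) (by norm_num)
  have hyR : y ∉ Set.range (algebraMap R Ω) := by
    rintro ⟨r, rfl⟩
    apply ha
    refine ⟨r, ?_⟩
    apply (algebraMap R Ω).injective
    rw [← hy, map_mul, sq]
  have hyi : IsIntegral R y := by
    refine ⟨X ^ 2 - C a, monic_X_pow_sub_C a (by norm_num), ?_⟩
    simp [hy]
  have hform : ∀ z ∈ R⟮y⟯, ∃ b c : R, z = algebraMap R Ω b + algebraMap R Ω c * y := by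
    intro z hz
    rw [← mem_toSubalgebra, adjoin_simple_toSubalgebra_of_isAlgebraic hyi.isAlgebraic] at hz
    induction hz using Algebra.adjoin_induction with
    | mem x hx => exact ⟨0, 1, by simp_all⟩
    | algebraMap r => exact ⟨r, 0, by simp⟩
    | add u v _ _ hu hv =>
      obtain ⟨b, c, rfl⟩ := hu
      obtain ⟨b', c', rfl⟩ := hv
      exact ⟨b + b', c + c', by simp only [map_add]; ring⟩
    | mul u v _ _ hu hv =>
      obtain ⟨b, c, rfl⟩ := hu
      obtain ⟨b', c', rfl⟩ := hv
      refine ⟨b * b' + c * c' * a, b * c' + c * b', ?_⟩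
      simp only [map_add, map_mul, ← hy]; ring
  have key : ∀ z : R⟮y⟯, IsSumSq z → ∃ s₁ s₂ w : R, IsSumSq s₁ ∧ IsSumSq s₂ ∧
      (z : Ω) = algebraMap R Ω (s₁ + a * s₂) + algebraMap R Ω w * y := by
    intro z hz
    induction hz with
    | zero => exact ⟨0, 0, 0, .zero, .zero, by simp⟩
    | @sq_add u s hs ih =>
      obtain ⟨s₁, s₂, w, h1, h2, h3⟩ := ih
      obtain ⟨b, c, hbc⟩ := hform u u.2
      refine ⟨b * b + s₁, c * c + s₂, 2 * b * c + w, .sq_add _ h1, .sq_add _ h2, ?_⟩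
      have : ((u * u + s : R⟮y⟯) : Ω) = u * u + s := rfl
      rw [this, h3, hbc]
      simp only [map_add, map_mul, ← hy, map_ofNat]; ring
  obtain ⟨s₁, s₂, w, h1, h2, h3⟩ := key _ (hmax y hyR)
  have h3' : (-1 : Ω) = algebraMap R Ω (s₁ + a * s₂) + algebraMap R Ω w * y := by
    rw [← h3]; simp
  have hw : w = 0 := by
    by_contra hw
    apply hyR
    refine ⟨(-1 - (s₁ + a * s₂)) / w, ?_⟩
    have hw' : algebraMap R Ω w ≠ 0 := by simpa using hw
    rw [map_div₀, map_sub, map_neg, map_one, div_eq_iff hw']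
    linear_combination h3'
  subst hw
  have h4 : (-1 : R) = s₁ + a * s₂ := by
    apply (algebraMap R Ω).injective
    simpa using h3'
  have hs2 : s₂ ≠ 0 := by
    rintro rfl
    exact IsSemireal.not_isSumSq_neg_one R (by simpa [h4] using h1)
  have : -a = (1 * 1 + s₁) * s₂ * (s₂⁻¹ * s₂⁻¹) := by
    field_simp
    linear_combination h4
  rw [this]
  exact ((IsSumSq.sq_add _ h1).mul h2).mul (.mul_self _)

open IntermediateField in
lemma odd_aux (hmax : ∀ y : Ω, y ∉ Set.range (algebraMap R Ω) → IsSumSq (-1 : R⟮y⟯))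
    (n : ℕ) : ∀ f : R[X], f.natDegree = n → Odd n → ∃ x, f.IsRoot x := by
  induction n using Nat.strong_induction_on with
  | _ n ih =>
  intro f hfn hn
  by_cases hirr : Irreducible f
  · obtain ⟨y, hy⟩ := IsAlgClosed.exists_aeval_eq_zero Ω f
      (by rw [degree_eq_natDegree hirr.ne_zero, hfn]; exact_mod_cast hn.pos.ne')
    by_cases hyR : y ∈ Set.range (algebraMap R Ω)
    · obtain ⟨r, rfl⟩ := hyR
      refine ⟨r, ?_⟩
      rw [aeval_algebraMap_apply] at hy
      simpa using hy
    have hyi : IsIntegral R y := by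
      rw [← isAlgebraic_iff_isIntegral]; exact ⟨f, hirr.ne_zero, hy⟩
    have hmd : Associated (minpoly R y) f :=
      (minpoly.irreducible hyi).associated_of_dvd hirr (minpoly.dvd R y hy)
    have hmn : (minpoly R y).natDegree = n := by
      rw [← hfn]; exact natDegree_eq_of_degree_eq (degree_eq_degree_of_associated hmd)
    have hform : ∀ z ∈ R⟮y⟯, ∃ g : R[X], g.natDegree ≤ n - 1 ∧ aeval y g = z := by
      intro z hz
      rw [← mem_toSubalgebra, adjoin_simple_toSubalgebra_of_isAlgebraic hyi.isAlgebraic,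
        Algebra.adjoin_singleton_eq_range_aeval] at hz
      obtain ⟨g, rfl⟩ := hz
      refine ⟨g %ₘ minpoly R y, ?_, ?_⟩
      · have := natDegree_modByMonic_lt g (minpoly.monic hyi) (minpoly.ne_one R y)
        omega
      · rw [aeval_modByMonic_eq_self_of_root (minpoly.aeval R y)]; rfl
    have key : ∀ z : R⟮y⟯, IsSumSq z → ∃ q : R[X], IsSumSq q ∧ q.natDegree ≤ 2 * (n - 1) ∧
        aeval y q = (z : Ω) := by
      intro z hz
      induction hz with
      | zero => exact ⟨0, .zero, by simp⟩
      | @sq_add u s hs ih =>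
        obtain ⟨q, h1, h2, h3⟩ := ih
        obtain ⟨g, hg1, hg2⟩ := hform u u.2
        refine ⟨g * g + q, .sq_add _ h1, ?_, ?_⟩
        · refine (natDegree_add_le _ _).trans (max_le ?_ h2)
          exact natDegree_mul_le.trans (by omega)
        · have : ((u * u + s : R⟮y⟯) : Ω) = u * u + s := rfl
          rw [this, map_add, map_mul, hg2, h3]
    obtain ⟨q, h1, h2, h3⟩ := key _ (hmax y hyR)
    have hq' : IsSumSq (1 * 1 + q) := .sq_add _ h1
    have hev : ∀ r, (1 * 1 + q).eval r ≠ 0 := by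
      intro r hr
      have : IsSumSq (q.eval r) := sumSq_map (evalRingHom r) h1
      rw [eval_add, mul_one, eval_one] at hr
      exact IsSemireal.one_add_ne_zero this hr
    have hq0 : (1 * 1 + q) ≠ 0 := by
      intro h; exact hev 0 (by rw [h]; simp)
    have hdvd : f ∣ (1 * 1 + q) := by
      refine hmd.symm.dvd.trans (minpoly.dvd R y ?_)
      rw [map_add, h3]; simp
    obtain ⟨h, hh⟩ := hdvd
    have hdeg : (1 * 1 + q).natDegree = n + h.natDegree := by
      rw [hh, natDegree_mul hirr.ne_zero (by rintro rfl; simp at hh; exact hq0 (by simpa using hh)), hfn]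
    have hle : (1 * 1 + q).natDegree ≤ 2 * (n - 1) :=
      (natDegree_add_le _ _).trans (max_le (by simp) h2)
    have heven := (poly_sumSq hq').1
    have hn1 := hn.pos
    rw [hdeg] at heven hle
    obtain ⟨r, hr⟩ := ih h.natDegree (by omega) h rfl (by
      rw [Nat.even_add] at heven
      rw [← Nat.not_even_iff_odd] at hn ⊢
      tauto)
    refine absurd ?_ (hev r)
    rw [hh, eval_mul, hr.eq_zero, mul_zero]
  · have hf0 : f ≠ 0 := by rintro rfl; simp at hfn; subst hfn; exact absurd hn (by decide)
    have hfu : ¬ IsUnit f := by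
      intro h
      rw [natDegree_eq_zero_of_isUnit h] at hfn; subst hfn; exact absurd hn (by decide)
    rw [irreducible_iff] at hirr
    push Not at hirr
    obtain ⟨a, b, hab, ha, hb⟩ := hirr hfu
    have ha0 : a ≠ 0 := by rintro rfl; simp at hab; exact hf0 hab
    have hb0 : b ≠ 0 := by rintro rfl; simp at hab; exact hf0 hab
    have hdeg : n = a.natDegree + b.natDegree := by rw [← hfn, hab, natDegree_mul ha0 hb0]
    have pa : 0 < a.natDegree := natDegree_pos_iff_degree_pos.mpr (degree_pos_of_ne_zero_of_nonunit ha0 ha)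
    have pb : 0 < b.natDegree := natDegree_pos_iff_degree_pos.mpr (degree_pos_of_ne_zero_of_nonunit hb0 hb)
    rcases Nat.even_or_odd a.natDegree with h | h
    · obtain ⟨x, hx⟩ := ih b.natDegree (by omega) b rfl (by
        rw [hdeg, Nat.odd_add] at hn
        rw [← Nat.not_even_iff_odd] at hn ⊢
        tauto)
      exact ⟨x, by rw [hab]; exact root_mul_left_of_isRoot _ hx⟩
    · obtain ⟨x, hx⟩ := ih a.natDegree (by omega) a rfl h
      exact ⟨x, by rw [hab]; exact root_mul_right_of_isRoot _ hx⟩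

open IntermediateField in
lemma isRealClosed_of_max (hmax : ∀ y : Ω, y ∉ Set.range (algebraMap R Ω) → IsSumSq (-1 : R⟮y⟯)) :
    IsRealClosed R where
  isSquare_or_isSquare_neg x := by
    by_contra! h
    have h1 := sq_or_aux hmax x h.1
    have h2 := sq_or_aux hmax (-x) h.2
    have hx : x ≠ 0 := by rintro rfl; exact h.1 (by simp)
    have : (-1 : R) = (-x) * (- -x) * (x⁻¹ * x⁻¹) := by field_simp
    exact IsSemireal.not_isSumSq_neg_one R (this ▸ (h1.mul h2).mul (.mul_self _))
  exists_isRoot_of_odd_natDegree {f} hf := odd_aux hmax _ f rfl hf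

open IntermediateField in
theorem exists_realClosed (K : Type) [Field K] (hK : ¬ IsSumSq (-1 : K)) :
    ∃ (R : Type) (_ : Field R) (_ : Algebra K R), IsRealClosed R := by
  let Ω := AlgebraicClosure K
  obtain ⟨M, hM⟩ := zorn_le_nonempty₀ {E : IntermediateField K Ω | ¬ IsSumSq (-1 : E)} (by
    intro c hc hchain E₀ hE₀
    refine ⟨sSup c, ?_, fun z hz => le_sSup hz⟩
    have hne : c.Nonempty := ⟨E₀, hE₀⟩
    have hdir : DirectedOn (· ≤ ·) c := hchain.directedOn
    have hmem : ∀ x, x ∈ sSup c → ∃ E ∈ c, x ∈ E := by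
      intro x hx
      rw [sSup_eq_iSup'] at hx
      have : Nonempty c := hne.to_subtype
      have := coe_iSup_of_directed (K := K) (L := Ω) (t := fun i : c => (i : IntermediateField K Ω)) hdir.directed_val
      rw [← SetLike.mem_coe, this, Set.mem_iUnion] at hx
      obtain ⟨i, hi⟩ := hx
      exact ⟨i, i.2, hi⟩
    have key : ∀ z : (sSup c : IntermediateField K Ω), IsSumSq z → ∃ E ∈ c, ∃ z' : E, IsSumSq z' ∧ (z' : Ω) = z := by
      intro z hz
      induction hz with
      | zero => exact ⟨E₀, hE₀, 0, .zero, by simp⟩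
      | @sq_add a s hs ih =>
        obtain ⟨E, hE, s', hs', hs''⟩ := ih
        obtain ⟨E', hE', ha⟩ := hmem a a.2
        obtain ⟨G, hG, h1, h2⟩ := hdir E hE E' hE'
        refine ⟨G, hG, ⟨a, h2 ha⟩ * ⟨a, h2 ha⟩ + inclusion h1 s', .sq_add _ (sumSq_map (inclusion h1).toRingHom hs'), ?_⟩
        simp [hs'']
    intro hneg
    obtain ⟨E, hE, z, hz, hz'⟩ := key _ hneg
    apply hc hE
    have : z = -1 := by apply Subtype.ext; rw [hz']; simp
    exact this ▸ hz) ⊥ (by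
      intro h
      apply hK
      simpa using sumSq_map (botEquiv K Ω : (⊥ : IntermediateField K Ω) →+* K) h)
  have hMs : ¬ IsSumSq (-1 : M) := hM.2.1
  have : IsSemireal M := IsSemireal.of_not_isSumSq_neg_one hMs
  refine ⟨M, inferInstance, inferInstance, isRealClosed_of_max (R := M) (Ω := Ω) ?_⟩
  intro y hy
  by_contra hcon
  apply hy
  have hle : M ≤ (M⟮y⟯).restrictScalars K := by
    intro x hx
    exact (M⟮y⟯).algebraMap_mem ⟨x, hx⟩
  have := hM.2.2 (y := (M⟮y⟯).restrictScalars K) (by exact hcon) hle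
  exact ⟨⟨y, this (mem_adjoin_simple_self M y)⟩, rfl⟩

end realclosure
end ArtinLang

namespace ArtinLang
open Polynomial

section order
theorem exists_order (R : Type*) [Field R] [IsRealClosed R] :
    ∃ (_ : LinearOrder R), IsStrictOrderedRing R := by
  classical
  have hadd : ∀ a b : R, IsSquare a → IsSquare b → IsSquare (a + b) := by
    rintro a b ha hb
    rcases IsRealClosed.isSquare_or_isSquare_neg (a + b) with h | h
    · exact h
    · have h0 : a + b = 0 := by
        have := sumSq_eq_zero (R := R) (a := a + b) (b := -(a+b)) (ha.isSumSq.add hb.isSumSq) h.isSumSq (by ring)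
        exact this
      rw [h0]; exact ⟨0, by simp⟩
  let le : R → R → Prop := fun x y => IsSquare (y - x)
  let po : PartialOrder R :=
    { le := fun x y => IsSquare (y - x)
      le_refl := fun x => ⟨0, by simp⟩
      le_trans := fun x y z h1 h2 => by
        have := hadd _ _ h1 h2
        rwa [show y - x + (z - y) = z - x by ring] at this
      le_antisymm := fun x y h1 h2 => by
        have := sumSq_eq_zero h1.isSumSq h2.isSumSq (by ring)
        linear_combination -this }
  let lo : LinearOrder R :=
    { po with
      le_total := fun x y => by
        rcases IsRealClosed.isSquare_or_isSquare_neg (y - x) with h | h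
        · exact .inl h
        · right; change IsSquare _; rwa [neg_sub] at h
      toDecidableLE := Classical.decRel _ }
  refine ⟨lo, ?_⟩
  have hle : ∀ x y : R, x ≤ y ↔ IsSquare (y - x) := fun x y => Iff.rfl
  have : IsOrderedAddMonoid R :=
    { add_le_add_left := fun a b h c => by
        rw [hle] at h ⊢
        rwa [show b + c - (a + c) = b - a by ring] }
  have : ZeroLEOneClass R := ⟨by rw [hle]; exact ⟨1, by simp⟩⟩
  have : IsOrderedRing R := .of_mul_nonneg fun a b ha hb => by
    rw [hle] at ha hb ⊢
    simp only [sub_zero] at *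
    exact ha.mul hb
  exact IsOrderedRing.toIsStrictOrderedRing R
end order

/-- `R(i)` -/
abbrev Ri (R : Type*) [Field R] := QuadraticAlgebra R (-1) 0

section algclosed
variable {R : Type*} [Field R] [LinearOrder R] [IsStrictOrderedRing R]

instance : Fact (∀ r : R, r ^ 2 ≠ (-1) + 0 * r) := ⟨fun r h => by nlinarith [sq_nonneg r]⟩

variable [IsRealClosed R]

lemma exists_sqrt (a : R) (ha : 0 ≤ a) : ∃ b, 0 ≤ b ∧ b ^ 2 = a := by
  obtain ⟨b, hb⟩ := IsRealClosed.nonneg_iff_isSquare.mp ha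
  exact ⟨|b|, abs_nonneg _, by rw [sq_abs, hb, sq]⟩

lemma Ri_isSquare (z : Ri R) : ∃ w : Ri R, w ^ 2 = z := by
  obtain ⟨m, hm0, hm⟩ := exists_sqrt (z.re ^ 2 + z.im ^ 2) (by positivity)
  have hre : |z.re| ≤ m := by
    apply abs_le_of_sq_le_sq _ hm0; nlinarith [sq_nonneg z.im]
  obtain ⟨h1, h2⟩ := abs_le.mp hre
  obtain ⟨u, hu0, hu⟩ := exists_sqrt ((m + z.re) / 2) (by linarith)
  obtain ⟨v, hv0, hv⟩ := exists_sqrt ((m - z.re) / 2) (by linarith)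
  have huv : (2 * (u * v)) ^ 2 = z.im ^ 2 := by
    have : (2 * (u * v)) ^ 2 = 4 * (u ^ 2 * v ^ 2) := by ring
    rw [this, hu, hv]; linear_combination hm
  rcases sq_eq_sq_iff_eq_or_eq_neg.mp huv with h | h
  · refine ⟨⟨u, v⟩, ?_⟩
    ext
    · simp [sq]; linear_combination hu - hv
    · simp [sq]; linear_combination h
  · refine ⟨⟨u, -v⟩, ?_⟩
    ext
    · simp [sq]; linear_combination hu - hv
    · simp [sq]; linear_combination -h

lemma odd_ext {M : Type*} [Field M] [Algebra R M] [FiniteDimensional R M]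
    (h : Odd (Module.finrank R M)) : Module.finrank R M = 1 := by
  obtain ⟨α, hα⟩ := Field.exists_primitive_element R M
  have hi : IsIntegral R α := .of_finite R α
  have hd : (minpoly R α).natDegree = Module.finrank R M := by
    rw [← IntermediateField.adjoin.finrank hi, hα, IntermediateField.finrank_top']
  rw [← hd] at h ⊢
  obtain ⟨x, hx⟩ := IsRealClosed.exists_isRoot_of_odd_natDegree h
  exact natDegree_eq_of_degree_eq_some (degree_eq_one_of_irreducible_of_root (minpoly.irreducible hi) hx)

lemma quad_ext {M : Type*} [Field M] [Algebra (Ri R) M] [FiniteDimensional (Ri R) M] :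
    Module.finrank (Ri R) M ≠ 2 := by
  intro h
  have hsurj : Function.Surjective (algebraMap (Ri R) M) := by
    intro y
    have hi : IsIntegral (Ri R) y := .of_finite _ y
    have hdeg : (minpoly (Ri R) y).natDegree ≤ 2 := h ▸ minpoly.natDegree_le y
    have h0 := minpoly.aeval (Ri R) y
    have hm := minpoly.monic hi
    have hpos := minpoly.natDegree_pos hi
    by_cases h1 : (minpoly (Ri R) y).natDegree = 1
    · rw [← minpoly.natDegree_eq_one_iff.mp h1 |>.choose_spec]
      exact ⟨_, rfl⟩
    · have h2 : (minpoly (Ri R) y).natDegree = 2 := by omega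
      rw [aeval_eq_sum_range, h2] at h0
      have hc : (minpoly (Ri R) y).coeff 2 = 1 := by rw [← h2]; exact hm
      simp only [Finset.sum_range_succ, Finset.range_zero, Finset.sum_empty, hc, Algebra.smul_def] at h0
      generalize (minpoly (Ri R) y).coeff 0 = c at h0
      generalize (minpoly (Ri R) y).coeff 1 = b at h0
      simp only [map_one] at h0
      obtain ⟨d, hd⟩ := Ri_isSquare (b ^ 2 - 4 * c)
      have hd' := congrArg (algebraMap (Ri R) M) hd
      simp only [map_pow, map_sub, map_mul, map_ofNat] at hd'
      have h4 : (2 * y + algebraMap _ _ b) ^ 2 = (algebraMap (Ri R) M d) ^ 2 := by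
        rw [hd']; linear_combination 4 * h0
      have : CharZero M := charZero_of_injective_algebraMap (algebraMap (Ri R) M).injective
      rcases sq_eq_sq_iff_eq_or_eq_neg.mp h4 with h | h
      · refine ⟨(d - b) / 2, ?_⟩
        simp only [map_div₀, map_sub, map_ofNat]
        field_simp
        linear_combination -h
      · refine ⟨(- d - b) / 2, ?_⟩
        simp only [map_div₀, map_sub, map_neg, map_ofNat]
        field_simp
        linear_combination -h
  have := LinearMap.finrank_le_finrank_of_surjective (f := Algebra.linearMap (Ri R) M) hsurj
  rw [h, Module.finrank_self] at this
  omega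

lemma galois_aux (L : Type*) [Field L] [Algebra R L] [Algebra (Ri R) L] [IsScalarTower R (Ri R) L]
    [FiniteDimensional R L] [IsGalois R L] : Module.finrank (Ri R) L = 1 := by
  have hfd : FiniteDimensional (Ri R) L := FiniteDimensional.right R (Ri R) L
  obtain ⟨P⟩ := Sylow.nonempty (p := 2) (G := L ≃ₐ[R] L)
  have hcG := IsGalois.card_aut_eq_finrank R L
  have h1 := IntermediateField.finrank_fixedField_eq_card (F := R) (E := L) (P : Subgroup (L ≃ₐ[R] L))
  have h2 := Module.finrank_mul_finrank R (IntermediateField.fixedField (P : Subgroup (L ≃ₐ[R] L))) L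
  have h3 := (P : Subgroup (L ≃ₐ[R] L)).card_mul_index
  have hodd : Odd (Module.finrank R (IntermediateField.fixedField (P : Subgroup (L ≃ₐ[R] L)))) := by
    have h4 := P.not_dvd_index
    have : Module.finrank R (IntermediateField.fixedField (P : Subgroup (L ≃ₐ[R] L)))
        = (P : Subgroup (L ≃ₐ[R] L)).index := by
      rw [h1, ← hcG, ← h3, mul_comm] at h2
      exact Nat.eq_of_mul_eq_mul_left Nat.card_pos h2
    rw [this]
    rw [← Nat.not_even_iff_odd, even_iff_two_dvd]; exact h4
  rw [odd_ext hodd, one_mul, h1] at h2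
  obtain ⟨k, hk⟩ := (IsPGroup.iff_card.mp P.isPGroup')
  have h5 := Module.finrank_mul_finrank R (Ri R) L
  have h6 : Module.finrank (Ri R) L ∣ 2 ^ k := by
    rw [← hk, h2, ← h5]; exact dvd_mul_left _ _
  obtain ⟨m, -, hm⟩ := (Nat.dvd_prime_pow Nat.prime_two).mp h6
  rcases m with _ | m
  · simpa using hm
  exfalso
  have : IsGalois (Ri R) L := IsGalois.tower_top_of_isGalois R (Ri R) L
  have hcH := IsGalois.card_aut_eq_finrank (Ri R) L
  obtain ⟨H, hH⟩ := Sylow.exists_subgroup_card_pow_prime (G := L ≃ₐ[Ri R] L) 2 (n := m)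
    (by rw [hcH, hm]; exact pow_dvd_pow _ (by omega))
  have h7 := IntermediateField.finrank_fixedField_eq_card (F := Ri R) (E := L) H
  have h8 := Module.finrank_mul_finrank (Ri R) (IntermediateField.fixedField H) L
  rw [h7, hH, hm, pow_succ, mul_comm] at h8
  exact quad_ext (Nat.eq_of_mul_eq_mul_left (by positivity) h8)

open IntermediateField in
instance : IsAlgClosed (Ri R) := by
  apply IsAlgClosed.of_exists_root
  intro p hp hirr
  let Ω := AlgebraicClosure (Ri R)
  obtain ⟨x, hx⟩ := IsAlgClosed.exists_aeval_eq_zero Ω p hirr.degree_pos.ne'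
  have hxi : IsIntegral (Ri R) x := ⟨p, hp, by rw [← aeval_def]; exact hx⟩
  have : FiniteDimensional (Ri R) (Ri R)⟮x⟯ := adjoin.finiteDimensional hxi
  let K₁ := (Ri R)⟮x⟯.restrictScalars R
  have : FiniteDimensional R K₁ := FiniteDimensional.trans R (Ri R) (Ri R)⟮x⟯
  have : Algebra.IsAlgebraic R Ω := Algebra.IsAlgebraic.trans R (Ri R) Ω
  let L := normalClosure R K₁ Ω
  have hle : K₁ ≤ L := le_normalClosure K₁
  let φ : Ri R →ₐ[R] L := (inclusion hle).comp ((IsScalarTower.toAlgHom R (Ri R) (Ri R)⟮x⟯))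
  let _ : Algebra (Ri R) L := φ.toRingHom.toAlgebra
  have : IsScalarTower R (Ri R) L := IsScalarTower.of_algebraMap_eq fun r => (φ.commutes r).symm
  have : Normal R Ω := normal_iff.mpr fun z => ⟨Algebra.IsIntegral.isIntegral z, IsAlgClosed.splits _⟩
  have : IsGalois R L := ⟨⟩
  have h1 := galois_aux (R := R) L
  have hxL : x ∈ L := hle (mem_adjoin_simple_self (Ri R) x)
  have := (finrank_eq_one_iff_of_nonzero' (1 : L) one_ne_zero).mp h1 ⟨x, hxL⟩
  obtain ⟨c, hc⟩ := this
  refine ⟨c, ?_⟩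
  have hcx : algebraMap (Ri R) Ω c = x := by
    have := congrArg (fun z : L => (z : Ω)) hc
    simp only [Algebra.smul_def, mul_one] at this
    exact this
  rw [← hcx, aeval_algebraMap_apply] at hx
  simpa using hx
end algclosed
end ArtinLang

namespace ArtinLang
open Polynomial

section sign
variable {R₁ R : Type*} [Field R₁] [LinearOrder R₁] [IsStrictOrderedRing R₁] [IsRealClosed R₁]
  [Field R] [LinearOrder R] [IsStrictOrderedRing R] [Algebra R₁ R]

lemma algebraMap_strictMono : StrictMono (algebraMap R₁ R) := by
  intro x y h
  obtain ⟨b, hb0, hb⟩ := exists_sqrt (y - x) (by linarith)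
  have hb1 : b ≠ 0 := by rintro rfl; simp at hb; linarith
  have : algebraMap R₁ R y - algebraMap R₁ R x = (algebraMap R₁ R b) ^ 2 := by
    rw [← map_sub, ← hb, map_pow]
  have h2 : 0 < (algebraMap R₁ R b) ^ 2 := by
    have : algebraMap R₁ R b ≠ 0 := by simpa using hb1
    positivity
  linarith

lemma mul_pos_neg' {F : Type*} [Field F] [LinearOrder F] [IsStrictOrderedRing F] {a b : F}
    (ha : a < 0) : 0 < a * b ↔ b < 0 := by
  rw [mul_pos_iff]
  constructor
  · rintro (h | h)
    · exact absurd h.1 ha.not_gt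
    · exact h.2
  · intro h; exact Or.inr ⟨ha, h⟩

lemma mul_neg_pos' {F : Type*} [Field F] [LinearOrder F] [IsStrictOrderedRing F] {a b : F}
    (ha : 0 < a) : a * b < 0 ↔ b < 0 := by
  rw [mul_neg_iff]
  constructor
  · rintro (h | h)
    · exact h.2
    · exact absurd h.1 ha.not_gt
  · intro h; exact Or.inl ⟨ha, h⟩

lemma quad_dvd (q : R₁[X]) (z : Ri R₁) (hz : aeval z q = 0) (him : z.im ≠ 0) :
    (X ^ 2 - C (2 * z.re) * X + C (z.re ^ 2 + z.im ^ 2)) ∣ q := by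
  set Q : R₁[X] := X ^ 2 - C (2 * z.re) * X + C (z.re ^ 2 + z.im ^ 2) with hQ
  have hQ' : Q = C 1 * X ^ 2 + C (-(2 * z.re)) * X + C (z.re ^ 2 + z.im ^ 2) := by
    rw [hQ]; simp; ring
  have hdeg : Q.natDegree = 2 := by rw [hQ']; exact natDegree_quadratic one_ne_zero
  have hmon : Q.Monic := by
    rw [Monic, hQ']; exact leadingCoeff_quadratic one_ne_zero
  have hQz : aeval z Q = 0 := by
    rw [hQ]
    ext
    · simp [sq]; ring
    · simp [sq]; ring
  rw [← modByMonic_eq_zero_iff_dvd hmon]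
  have hlt := natDegree_modByMonic_lt q hmon (by intro h; rw [h] at hdeg; simp at hdeg)
  rw [hdeg] at hlt
  have hr := exists_eq_X_add_C_of_natDegree_le_one (p := q %ₘ Q) (by omega)
  have h0 : aeval z (q %ₘ Q) = 0 := by rw [aeval_modByMonic_eq_self_of_root hQz, hz]
  obtain ⟨a, b, hab⟩ := hr
  rw [hab] at h0 ⊢
  have h1 := congrArg QuadraticAlgebra.im h0
  have h2 := congrArg QuadraticAlgebra.re h0
  simp at h1 h2
  have ha : a = 0 := by tauto
  subst ha
  simp at h2
  subst h2
  simp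

lemma sign_aux (n : ℕ) : ∀ (q : R₁[X]) (t : R) (c : R₁), q.natDegree = n → q ≠ 0 →
    (∀ r, q.IsRoot r → c ≠ r ∧ t ≠ algebraMap R₁ R r ∧ (r < c ↔ algebraMap R₁ R r < t)) →
    ((0 < aeval t q ↔ 0 < q.eval c) ∧ (aeval t q < 0 ↔ q.eval c < 0)) := by
  induction n using Nat.strong_induction_on with
  | _ n ih =>
  intro q t c hn hq hr
  have hmono := algebraMap_strictMono (R₁ := R₁) (R := R)
  by_cases hn0 : n = 0
  · subst hn0
    rw [eq_C_of_natDegree_eq_zero hn]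
    simp only [aeval_C, eval_C]
    rw [← map_zero (algebraMap R₁ R), hmono.lt_iff_lt, hmono.lt_iff_lt]; simp
  obtain ⟨z, hz⟩ := IsAlgClosed.exists_aeval_eq_zero (Ri R₁) q
      (by rw [degree_eq_natDegree hq, hn]; exact_mod_cast hn0)
  by_cases him : z.im = 0
  · have hroot : q.IsRoot z.re := by
      have : z = algebraMap R₁ (Ri R₁) z.re := by ext <;> simp [him]
      rw [this, aeval_algebraMap_apply] at hz
      simpa using hz
    obtain ⟨g, hg⟩ := dvd_iff_isRoot.mpr hroot
    have hg0 : g ≠ 0 := by rintro rfl; simp at hg; exact hq hg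
    have hgn : g.natDegree < n := by
      rw [← hn, hg, natDegree_mul (X_sub_C_ne_zero _) hg0, natDegree_X_sub_C]; omega
    obtain ⟨i1, i2⟩ := ih _ hgn g t c rfl hg0 (fun r h => hr r (by rw [hg]; exact root_mul_left_of_isRoot _ h))
    obtain ⟨e1, e2, e3⟩ := hr _ hroot
    generalize z.re = r at *
    rw [hg]
    simp only [map_mul, map_sub, aeval_X, aeval_C, eval_mul, eval_sub, eval_X, eval_C]
    rcases lt_or_gt_of_ne e1 with h | h
    · have h' : t < algebraMap R₁ R r := by
        rcases lt_or_gt_of_ne e2 with h' | h'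
        · exact h'
        · exact absurd (e3.mpr h') (by exact not_lt.mpr h.le)
      constructor
      · rw [mul_pos_neg' (by linarith), mul_pos_neg' (by linarith), i2]
      · rw [mul_neg_iff, mul_neg_iff, i1]
        constructor <;> intro hh <;> right <;> constructor <;> (try linarith) <;>
          rcases hh with hh | hh <;> linarith [hh.1, hh.2]
    · have h' := e3.mp h
      constructor
      · rw [mul_pos_iff_of_pos_left (by linarith), mul_pos_iff_of_pos_left (by linarith), i1]
      · rw [mul_neg_pos' (by linarith), mul_neg_pos' (by linarith), i2]
  · obtain ⟨g, hg⟩ := quad_dvd q z hz him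
    have hg0 : g ≠ 0 := by rintro rfl; simp at hg; exact hq hg
    have hQ' : (X ^ 2 - C (2 * z.re) * X + C (z.re ^ 2 + z.im ^ 2)) = C 1 * X ^ 2 + C (-(2 * z.re)) * X + C (z.re ^ 2 + z.im ^ 2) := by
      simp; ring
    have hdeg : (X ^ 2 - C (2 * z.re) * X + C (z.re ^ 2 + z.im ^ 2)).natDegree = 2 := by
      rw [hQ']; exact natDegree_quadratic one_ne_zero
    have hgn : g.natDegree < n := by
      rw [← hn, hg, natDegree_mul (by intro h; rw [h] at hdeg; simp at hdeg) hg0, hdeg]; omega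
    obtain ⟨i1, i2⟩ := ih _ hgn g t c rfl hg0 (fun r h => hr r (by rw [hg]; exact root_mul_left_of_isRoot _ h))
    have p1 : 0 < aeval t (X ^ 2 - C (2 * z.re) * X + C (z.re ^ 2 + z.im ^ 2)) := by
      have : aeval t (X ^ 2 - C (2 * z.re) * X + C (z.re ^ 2 + z.im ^ 2)) =
        (t - algebraMap R₁ R z.re) ^ 2 + (algebraMap R₁ R z.im) ^ 2 := by
        simp only [map_add, map_sub, map_mul, map_pow, aeval_X, aeval_C, map_ofNat]; ring
      rw [this]
      have : algebraMap R₁ R z.im ≠ 0 := by simpa using him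
      positivity
    have p2 : 0 < eval c (X ^ 2 - C (2 * z.re) * X + C (z.re ^ 2 + z.im ^ 2)) := by
      have : eval c (X ^ 2 - C (2 * z.re) * X + C (z.re ^ 2 + z.im ^ 2)) =
        (c - z.re) ^ 2 + (z.im) ^ 2 := by
        simp; ring
      rw [this]
      positivity
    rw [hg, map_mul, eval_mul]
    rw [mul_pos_iff_of_pos_left p1, mul_pos_iff_of_pos_left p2,
      mul_neg_pos' p1, mul_neg_pos' p2]
    exact ⟨i1, i2⟩

lemma exists_c (t : R) (ht : Transcendental R₁ t) (Q : Finset R₁[X]) :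
    ∃ c : R₁, ∀ q ∈ Q, q ≠ 0 → q.eval c ≠ 0 ∧ (0 < aeval t q → 0 < q.eval c) := by
  classical
  let Z : Finset R₁ := Q.biUnion fun q => q.roots.toFinset
  have hne : ∀ r : R₁, t ≠ algebraMap R₁ R r := by
    rintro r rfl
    exact ht (isAlgebraic_algebraMap r)
  have hmono := algebraMap_strictMono (R₁ := R₁) (R := R)
  obtain ⟨c, hc1, hc2⟩ := Order.exists_between_finsets (Z.filter (fun r => algebraMap R₁ R r < t))
    (Z.filter (fun r => t < algebraMap R₁ R r)) (by
      intro x hx y hy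
      simp only [Finset.mem_filter] at hx hy
      exact hmono.lt_iff_lt.mp (hx.2.trans hy.2))
  refine ⟨c, fun q hq hq0 => ?_⟩
  have key : ∀ r, q.IsRoot r → c ≠ r ∧ t ≠ algebraMap R₁ R r ∧ (r < c ↔ algebraMap R₁ R r < t) := by
    intro r hr
    have hrZ : r ∈ Z := by
      simp only [Z, Finset.mem_biUnion, Multiset.mem_toFinset]
      exact ⟨q, hq, (mem_roots hq0).mpr hr⟩
    rcases lt_or_gt_of_ne (hne r) with h | h
    · have := hc2 r (by simp [hrZ, h])
      exact ⟨this.ne, hne r, ⟨fun h' => absurd h' this.not_gt, fun h' => absurd h' h.not_gt⟩⟩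
    · have := hc1 r (by simp [hrZ, h])
      exact ⟨this.ne', hne r, ⟨fun h' => h, fun h' => this⟩⟩
  have := sign_aux _ q t c rfl hq0 key
  refine ⟨fun h0 => (key c h0).1 rfl, this.1.mp⟩
end sign

section hankel

/-- universal polynomial expressing power sums by elementary symmetric ones -/
noncomputable def powN (n k : ℕ) : MvPolynomial (Fin n) ℤ :=
  ((MvPolynomial.esymmAlgHom_fin_bijective ℤ n).2
    ⟨MvPolynomial.psum (Fin n) ℤ k, MvPolynomial.psum_isSymmetric _ _ k⟩).choose

lemma powN_spec (n k : ℕ) :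
    MvPolynomial.aeval (fun i : Fin n => MvPolynomial.esymm (Fin n) ℤ (i + 1)) (powN n k) =
      MvPolynomial.psum (Fin n) ℤ k := by
  have := ((MvPolynomial.esymmAlgHom_fin_bijective ℤ n).2
    ⟨MvPolynomial.psum (Fin n) ℤ k, MvPolynomial.psum_isSymmetric _ _ k⟩).choose_spec
  have h := congrArg Subtype.val this
  rw [MvPolynomial.esymmAlgHom_apply] at h
  exact h

/-- power sums of roots in terms of coefficients -/
noncomputable def pw {A : Type*} [CommRing A] (n : ℕ) (f : A[X]) (k : ℕ) : A :=
  MvPolynomial.aeval (fun i : Fin n => (-1) ^ ((i : ℕ) + 1) * f.coeff (n - (i + 1))) (powN n k)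

lemma pw_map {A B : Type*} [CommRing A] [CommRing B] (φ : A →+* B) (n : ℕ) (f : A[X]) (k : ℕ) :
    φ (pw n f k) = pw n (f.map φ) k := by
  unfold pw
  rw [MvPolynomial.aeval_def, MvPolynomial.aeval_def, MvPolynomial.hom_eval₂]
  congr 1
  · exact RingHom.ext_int _ _
  · ext i; simp

lemma pw_roots {C : Type*} [Field C] (f : C[X]) (hf : f.Monic) (n : ℕ) (hn : f.natDegree = n)
    (hs : f.roots.card = n) (k : ℕ) : pw n f k = (f.roots.map (fun z => z ^ k)).sum := by
  obtain ⟨g, hg⟩ : ∃ g : Fin n → C, (Finset.univ : Finset (Fin n)).val.map g = f.roots := by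
    subst hn
    rw [← Multiset.length_toList] at hs
    refine ⟨fun i => f.roots.toList.get (i.cast hs.symm), ?_⟩
    conv_rhs => rw [← Multiset.coe_toList f.roots]
    rw [Fin.univ_val_map]
    congr 1
    apply List.ext_get
    · simpa using hs.symm
    · intro m h1 h2; simp
  have hcoef : ∀ i : Fin n, (-1) ^ ((i : ℕ) + 1) * f.coeff (n - (i + 1)) =
      MvPolynomial.aeval g (MvPolynomial.esymm (Fin n) ℤ (i + 1)) := by
    intro i
    rw [MvPolynomial.aeval_esymm_eq_multiset_esymm, hg,
      coeff_eq_esymm_roots_of_card (by rw [hs, hn]) (by omega), hf, hn]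
    have : n - (n - (i + 1 : ℕ)) = i + 1 := by omega
    rw [this, one_mul, ← mul_assoc, ← mul_pow]; simp
  unfold pw
  simp_rw [hcoef]
  rw [← hg]
  rw [← MvPolynomial.comp_aeval_apply, powN_spec]
  simp [MvPolynomial.psum, List.sum_ofFn]

/-- Hermite matrix -/
noncomputable def Hm {A : Type*} [CommRing A] (n : ℕ) (f : A[X]) : Matrix (Fin n) (Fin n) A :=
  Matrix.of fun i j => pw n f (i + j)

lemma Hm_map {A B : Type*} [CommRing A] [CommRing B] (φ : A →+* B) (n : ℕ) (f : A[X]) :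
    (Hm n f).map φ = Hm n (f.map φ) := by
  ext i j; simp [Hm, pw_map]

lemma Hm_symm {A : Type*} [CommRing A] (n : ℕ) (f : A[X]) : (Hm n f).IsSymm := by
  ext i j; simp [Hm, add_comm]
end hankel
end ArtinLang

namespace ArtinLang
open Polynomial
section sig
variable {R : Type*} [Field R] [LinearOrder R] [IsStrictOrderedRing R] [IsRealClosed R]

/-- evaluation of the coefficient vector `v` as polynomial at `z` -/
noncomputable def pv {n : ℕ} (z : Ri R) : (Fin n → R) →ₗ[R] Ri R :=
  Fintype.linearCombination R (fun i : Fin n => z ^ (i : ℕ))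

lemma pv_apply {n : ℕ} (z : Ri R) (v : Fin n → R) : pv z v = ∑ i, v i • z ^ (i : ℕ) := by
  simp [pv, Fintype.linearCombination_apply]

lemma pv_star {n : ℕ} (z : Ri R) (v : Fin n → R) : pv (star z) v = star (pv z v) := by
  rw [pv_apply, pv_apply, star_sum]
  refine Finset.sum_congr rfl fun i _ => ?_
  rw [← star_pow]
  generalize z ^ (i : ℕ) = w
  ext <;> simp

lemma pv_real {n : ℕ} (z : Ri R) (hz : z.im = 0) (v : Fin n → R) : (pv z v).im = 0 := by
  have h : star z = z := by ext <;> simp [hz]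
  have h2 := congrArg QuadraticAlgebra.im (pv_star z v)
  rw [h] at h2
  simp at h2
  linarith

/-- complex roots -/
noncomputable def cr (f : R[X]) : Multiset (Ri R) := (f.map (algebraMap R (Ri R))).roots

lemma cr_card (f : R[X]) : (cr f).card = f.natDegree := by
  rw [cr, ← natDegree_map (algebraMap R (Ri R))]
  exact (IsAlgClosed.splits _).natDegree_eq_card_roots.symm

lemma cr_star (f : R[X]) : (cr f).map star = cr f := by
  have h := roots_map_of_injective_of_card_eq_natDegree
    (f := (starRingEnd (Ri R))) (p := f.map (algebraMap R (Ri R))) (RingHom.injective _)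
    (by rw [natDegree_map]; exact cr_card f)
  have h2 : (f.map (algebraMap R (Ri R))).map (starRingEnd (Ri R)) = f.map (algebraMap R (Ri R)) := by
    rw [map_map]
    congr 1
    ext r <;> simp [starRingEnd_apply]
  rw [h2] at h
  exact h

lemma quad_eq {n : ℕ} (f : R[X]) (hf : f.Monic) (hn : f.natDegree = n) (v : Fin n → R) :
    v ⬝ᵥ (Hm n f).mulVec v = ((cr f).map fun z => (pv z v).re ^ 2 - (pv z v).im ^ 2).sum := by
  have h1 : algebraMap R (Ri R) (v ⬝ᵥ (Hm n f).mulVec v) = ((cr f).map fun z => (pv z v) ^ 2).sum := by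
    have hp : ∀ k, algebraMap R (Ri R) (pw n f k) = ((cr f).map (fun z => z ^ k)).sum := by
      intro k
      rw [pw_map, pw_roots _ (hf.map _) n (by rw [natDegree_map, hn]) (by rw [← hn]; exact cr_card f)]
      rfl
    simp only [dotProduct, Matrix.mulVec, map_sum, map_mul, Hm, Matrix.of_apply, hp]
    have : ∀ z : Ri R, (pv z v) ^ 2 = ∑ i : Fin n, ∑ j : Fin n, algebraMap R (Ri R) (v i) * (z ^ ((i : ℕ) + (j : ℕ)) * algebraMap R (Ri R) (v j)) := by
      intro z
      rw [pv_apply, sq, Finset.sum_mul_sum]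
      refine Finset.sum_congr rfl fun i _ => Finset.sum_congr rfl fun j _ => ?_
      rw [Algebra.smul_def, Algebra.smul_def]; ring
    simp_rw [this, Multiset.sum_map_sum, Multiset.sum_map_mul_left, Multiset.sum_map_mul_right, Finset.mul_sum]
  have h2 := congrArg (QuadraticAlgebra.reₗ (-1 : R) 0) h1
  rw [map_multiset_sum, Multiset.map_map] at h2
  have h3 : v ⬝ᵥ (Hm n f).mulVec v = (QuadraticAlgebra.reₗ (-1 : R) 0) (algebraMap R (Ri R) (v ⬝ᵥ (Hm n f).mulVec v)) := by
    simp
  rw [h3, h2]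
  congr 1
  refine Multiset.map_congr rfl fun z _ => ?_
  simp [sq]; ring

/-- upper half plane roots -/
noncomputable def up (f : R[X]) : Finset (Ri R) := by
  classical exact ((cr f).filter (fun z => 0 < z.im)).toFinset

lemma mem_up (f : R[X]) (z : Ri R) : z ∈ up f ↔ z ∈ cr f ∧ 0 < z.im := by
  simp [up]

lemma star_mem (f : R[X]) (z : Ri R) (h : z ∈ cr f) : star z ∈ cr f := by
  rw [← cr_star f]; exact Multiset.mem_map_of_mem _ h

lemma up_card_aux (f : R[X]) : 2 * (up f).card + ((cr f).filter (fun z => z.im = 0)).card ≤ f.natDegree := by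
  classical
  have h1 : (up f).card ≤ ((cr f).filter (fun z => 0 < z.im)).card := by
    unfold up; exact Multiset.toFinset_card_le _
  have h2 : ((cr f).filter (fun z => z.im < 0)).card = ((cr f).filter (fun z => 0 < z.im)).card := by
    conv_lhs => rw [← cr_star f]
    rw [Multiset.filter_map, Multiset.card_map]
    congr 1
    refine Multiset.filter_congr fun z _ => ?_
    simp
  have h3 : (cr f).card = ((cr f).filter (fun z => 0 < z.im)).card +
    (((cr f).filter (fun z => z.im < 0)).card + ((cr f).filter (fun z => z.im = 0)).card) := by
    conv_lhs => rw [← Multiset.filter_add_not (fun z => 0 < z.im) (cr f), Multiset.card_add]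
    congr 1
    conv_lhs => rw [← Multiset.filter_add_not (fun z => z.im < 0) (Multiset.filter _ (cr f)), Multiset.card_add]
    rw [Multiset.filter_filter, Multiset.filter_filter]
    congr 2
    · refine Multiset.filter_congr fun z _ => ?_
      constructor
      · exact fun h => h.1
      · exact fun h => ⟨h, h.not_gt⟩
    · refine Multiset.filter_congr fun z _ => ?_
      constructor
      · exact fun h => le_antisymm (not_lt.mp h.2) (not_lt.mp h.1)
      · intro h; rw [h]; simp
  rw [cr_card] at h3
  omega

lemma exists_ker {n : ℕ} {ι : Type*} [Fintype ι] (L : ι → ((Fin n → R) →ₗ[R] R))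
    (h : Fintype.card ι < n) : ∃ x : Fin n → R, x ≠ 0 ∧ ∀ i, L i x = 0 := by
  have := LinearMap.ker_ne_bot_of_finrank_lt (f := LinearMap.pi L) (by simpa using h)
  obtain ⟨x, hx, hx0⟩ := Submodule.exists_mem_ne_zero_of_ne_bot this
  refine ⟨x, hx0, fun i => ?_⟩
  have := congrFun (LinearMap.mem_ker.mp hx) i
  simpa using this

lemma diag_eval {n : ℕ} (H P : Matrix (Fin n) (Fin n) R) (d : Fin n → R)
    (h : P.transpose * H * P = Matrix.diagonal d) (x : Fin n → R) :
    (P.mulVec x) ⬝ᵥ H.mulVec (P.mulVec x) = ∑ i, d i * x i ^ 2 := by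
  have : (P.mulVec x) ⬝ᵥ H.mulVec (P.mulVec x) = x ⬝ᵥ (P.transpose * H * P).mulVec x := by
    rw [← Matrix.mulVec_mulVec, ← Matrix.mulVec_mulVec, Matrix.dotProduct_mulVec x,
      Matrix.vecMul_transpose]
  rw [this, h]
  simp only [dotProduct, Matrix.mulVec_diagonal]
  exact Finset.sum_congr rfl fun i _ => by ring

lemma claimA {n : ℕ} (f : R[X]) (hf : f.Monic) (hn : f.natDegree = n)
    (hnd : (cr f).Nodup) (r : R) (hr : f.IsRoot r)
    (P Q : Matrix (Fin n) (Fin n) R) (d : Fin n → R) (hQP : Q * P = 1)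
    (h : P.transpose * Hm n f * P = Matrix.diagonal d) :
    n < 2 * Fintype.card {i // 0 < d i} := by
  classical
  by_contra hcon
  push Not at hcon
  have hU : 2 * (up f).card < n := by
    have h1 := up_card_aux f
    have h2 : 0 < ((cr f).filter (fun z => z.im = 0)).card := by
      rw [Multiset.card_pos_iff_exists_mem]
      refine ⟨algebraMap R (Ri R) r, ?_⟩
      rw [Multiset.mem_filter]
      refine ⟨?_, by simp⟩
      rw [cr, mem_roots (hf.map _).ne_zero]
      exact hr.map
    omega
  obtain ⟨x, hx0, hx⟩ := exists_ker (R := R) (n := n) (ι := up f ⊕ {i // 0 < d i})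
    (Sum.elim (fun z => (QuadraticAlgebra.imₗ (-1 : R) 0) ∘ₗ pv z.1 ∘ₗ P.mulVecLin)
      (fun i => LinearMap.proj i.1)) (by
      rw [Fintype.card_sum, Fintype.card_coe]; omega)
  have him : ∀ z ∈ cr f, (pv z (P.mulVec x)).im = 0 := by
    have h1 : ∀ z ∈ up f, (pv z (P.mulVec x)).im = 0 := fun z hz => by
      simpa using hx (Sum.inl ⟨z, hz⟩)
    intro z hz
    rcases lt_trichotomy z.im 0 with h | h | h
    · have := h1 (star z) ((mem_up _ _).mpr ⟨star_mem f z hz, by simpa using h⟩)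
      rw [pv_star] at this
      simpa using this
    · exact pv_real z h _
    · exact h1 z ((mem_up _ _).mpr ⟨hz, h⟩)
  have hd : ∀ i, 0 < d i → x i = 0 := fun i hi => by simpa using hx (Sum.inr ⟨i, hi⟩)
  have e1 := quad_eq f hf hn (P.mulVec x)
  rw [diag_eval _ _ _ h] at e1
  have e2 : ∑ i, d i * x i ^ 2 ≤ 0 := by
    refine Finset.sum_nonpos fun i _ => ?_
    by_cases hi : 0 < d i
    · simp [hd i hi]
    · exact mul_nonpos_of_nonpos_of_nonneg (not_lt.mp hi) (sq_nonneg _)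
  have hnn : ∀ y ∈ ((cr f).map fun z => (pv z (P.mulVec x)).re ^ 2 - (pv z (P.mulVec x)).im ^ 2), 0 ≤ y := by
    intro y hy
    obtain ⟨z, hz, rfl⟩ := Multiset.mem_map.mp hy
    rw [him z hz]
    nlinarith [sq_nonneg (pv z (P.mulVec x)).re]
  have hz0 : ∀ z ∈ cr f, pv z (P.mulVec x) = 0 := by
    intro z hz
    have h1 := Multiset.single_le_sum hnn _ (Multiset.mem_map_of_mem _ hz)
    rw [him z hz] at h1
    have h2 : (pv z (P.mulVec x)).re ^ 2 ≤ 0 := by linarith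
    ext
    · simpa using le_antisymm h2 (sq_nonneg _)
    · exact him z hz
  have hp0 : P.mulVec x = 0 := by
    let p : (Ri R)[X] := ∑ i : Fin n, C (algebraMap R (Ri R) (P.mulVec x i)) * X ^ (i : ℕ)
    have hpev : ∀ z, p.eval z = pv z (P.mulVec x) := by
      intro z
      simp only [p, pv_apply, eval_finsetSum, eval_mul, eval_C, eval_pow, eval_X, Algebra.smul_def]
    have hpdeg : p.degree < n := by
      refine (degree_sum_le _ _).trans_lt ?_
      refine (Finset.sup_lt_iff (WithBot.bot_lt_coe n)).mpr ?_
      intro i _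
      refine (degree_C_mul_X_pow_le _ _).trans_lt ?_
      exact WithBot.coe_lt_coe.mpr i.2
    have hpz : p = 0 := by
      refine eq_zero_of_degree_lt_of_eval_finset_eq_zero (s := (cr f).toFinset) ?_ ?_
      · rw [Multiset.toFinset_card_of_nodup hnd, cr_card, hn]; exact hpdeg
      · intro z hz
        rw [hpev]; exact hz0 z (by simpa using hz)
    ext i
    have := congrArg (fun q => coeff q i) hpz
    simp only [p, finsetSum_coeff, coeff_C_mul_X_pow, coeff_zero] at this
    rw [Finset.sum_eq_single i] at this
    · simpa using this
    · intro j _ hj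
      rw [if_neg]
      intro h; exact hj (Fin.ext h.symm)
    · simp
  apply hx0
  have := congrArg Q.mulVec hp0
  rw [Matrix.mulVec_mulVec, hQP] at this
  simpa using this

lemma claimB {n : ℕ} (f : R[X]) (hf : f.Monic) (hn : f.natDegree = n)
    (P : Matrix (Fin n) (Fin n) R) (d : Fin n → R)
    (h : P.transpose * Hm n f * P = Matrix.diagonal d)
    (hc : n < 2 * Fintype.card {i // 0 < d i}) : ∃ r, f.IsRoot r := by
  classical
  by_contra hcon
  push Not at hcon
  have hreal : ∀ z ∈ cr f, z.im ≠ 0 := by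
    intro z hz him
    apply hcon z.re
    have h1 : z = algebraMap R (Ri R) z.re := by ext <;> simp [him]
    rw [cr, mem_roots (hf.map _).ne_zero, h1] at hz
    exact IsRoot.of_map hz (algebraMap R (Ri R)).injective
  have hU := up_card_aux f
  have hcomp := Fintype.card_subtype_compl (fun i => 0 < d i)
  have hcle := Fintype.card_subtype_le (fun i => 0 < d i)
  rw [Fintype.card_fin] at hcomp hcle
  obtain ⟨x, hx0, hx⟩ := exists_ker (R := R) (n := n) (ι := up f ⊕ {i // ¬ 0 < d i})
    (Sum.elim (fun z => (QuadraticAlgebra.reₗ (-1 : R) 0) ∘ₗ pv z.1 ∘ₗ P.mulVecLin)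
      (fun i => LinearMap.proj i.1)) (by
      rw [Fintype.card_sum, Fintype.card_coe, hcomp]; omega)
  have hre : ∀ z ∈ cr f, (pv z (P.mulVec x)).re = 0 := by
    have h1 : ∀ z ∈ up f, (pv z (P.mulVec x)).re = 0 := fun z hz => by
      simpa using hx (Sum.inl ⟨z, hz⟩)
    intro z hz
    rcases lt_or_gt_of_ne (hreal z hz) with h | h
    · have := h1 (star z) ((mem_up _ _).mpr ⟨star_mem f z hz, by simpa using h⟩)
      rw [pv_star] at this
      simpa using this
    · exact h1 z ((mem_up _ _).mpr ⟨hz, h⟩)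
  have hd : ∀ i, ¬ 0 < d i → x i = 0 := fun i hi => by simpa using hx (Sum.inr ⟨i, hi⟩)
  have e1 := quad_eq f hf hn (P.mulVec x)
  rw [diag_eval _ _ _ h] at e1
  have e2 : 0 < ∑ i, d i * x i ^ 2 := by
    obtain ⟨i, hi⟩ := Function.ne_iff.mp hx0
    refine Finset.sum_pos' (fun j _ => ?_) ⟨i, Finset.mem_univ _, ?_⟩
    · by_cases hj : 0 < d j
      · positivity
      · simp [hd j hj]
    · have hdi : 0 < d i := by
        by_contra h'; exact hi (hd i h')
      have : x i ≠ 0 := hi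
      positivity
  have e3 : ((cr f).map fun z => (pv z (P.mulVec x)).re ^ 2 - (pv z (P.mulVec x)).im ^ 2).sum ≤ 0 := by
    have : 0 ≤ ((cr f).map fun z => -((pv z (P.mulVec x)).re ^ 2 - (pv z (P.mulVec x)).im ^ 2)).sum := by
      refine Multiset.sum_nonneg fun y hy => ?_
      obtain ⟨z, hz, rfl⟩ := Multiset.mem_map.mp hy
      rw [hre z hz]
      nlinarith [sq_nonneg (pv z (P.mulVec x)).im]
    rw [Multiset.sum_map_neg] at this
    linarith
  linarith

end sig

lemma exists_diag {F : Type*} [Field F] [CharZero F] {n : ℕ} (H : Matrix (Fin n) (Fin n) F)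
    (hH : H.IsSymm) : ∃ (P Q : Matrix (Fin n) (Fin n) F) (d : Fin n → F), Q * P = 1 ∧
      P.transpose * H * P = Matrix.diagonal d := by
  have : Invertible (2 : F) := invertibleOfNonzero two_ne_zero
  let B := Matrix.toBilin' H
  have hB : LinearMap.IsSymm B := by
    constructor
    intro x y
    simp only [B, Matrix.toBilin'_apply', RingHom.id_apply]
    rw [Matrix.dotProduct_mulVec, dotProduct_comm, ← Matrix.mulVec_transpose, hH]
  obtain ⟨v, hv⟩ := LinearMap.BilinForm.exists_orthogonal_basis hB
  let w : Module.Basis (Fin n) F (Fin n → F) := v.reindex (finCongr (by simp))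
  refine ⟨(Pi.basisFun F (Fin n)).toMatrix w, w.toMatrix (Pi.basisFun F (Fin n)), fun i => B (w i) (w i), ?_, ?_⟩
  · exact w.toMatrix_mul_toMatrix_flip _
  · have := LinearMap.BilinForm.toMatrix_mul_basis_toMatrix (Pi.basisFun F (Fin n)) w B
    have h2 : LinearMap.BilinForm.toMatrix (Pi.basisFun F (Fin n)) B = H := by
      rw [LinearMap.BilinForm.toMatrix_basisFun]; simp [B]
    rw [← h2, this]
    ext i j
    rw [LinearMap.BilinForm.toMatrix_apply, Matrix.diagonal_apply]
    split_ifs with hij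
    · rw [hij]
    · simp only [w, Module.Basis.reindex_apply]
      apply hv
      simpa using hij
end ArtinLang

namespace ArtinLang
open Polynomial
section curve
variable {R₁ R : Type*} [Field R₁] [LinearOrder R₁] [IsStrictOrderedRing R₁] [IsRealClosed R₁]
  [Field R] [LinearOrder R] [IsStrictOrderedRing R] [Algebra R₁ R]

open IntermediateField in
lemma specialize (t : R) (ht : Transcendental R₁ t) (U : Set R₁⟮t⟯) (hU : U.Finite) :
    ∃ (B : Subalgebra R₁ R₁⟮t⟯) (φ : B →ₐ[R₁] R₁), ∀ u ∈ U, ∃ h : u ∈ B,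
      (0 < (u : R) → 0 < φ ⟨u, h⟩) := by
  classical
  have hrep : ∀ u : R₁⟮t⟯, ∃ p q : R₁[X], aeval t q ≠ 0 ∧ (u : R) * aeval t q = aeval t p := by
    intro u
    obtain ⟨p, q, h⟩ := (mem_adjoin_simple_iff R₁ (u : R)).mp u.2
    by_cases hq : aeval t q = 0
    · refine ⟨0, 1, by simp, ?_⟩
      rw [h, hq]; simp
    · exact ⟨p, q, hq, by rw [h]; field_simp⟩
  choose p q hq hpq using hrep
  obtain ⟨c, hc⟩ := exists_c t ht ((hU.toFinset.image q) ∪ hU.toFinset.image (fun u => p u * q u))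
  have hq0 : ∀ u, q u ≠ 0 := fun u h => hq u (by rw [h]; simp)
  let M : Submonoid R₁[X] := (nonZeroDivisors R₁).comap (evalRingHom c)
  have hM : ∀ r ∈ M, r.eval c ≠ 0 := fun r hr => nonZeroDivisors.ne_zero hr
  have hM' : M ≤ nonZeroDivisors R₁[X] := fun r hr =>
    mem_nonZeroDivisors_of_ne_zero (by rintro rfl; exact hM _ hr (by simp))
  let τ : R₁[X] →ₐ[R₁] R₁⟮t⟯ := aeval (AdjoinSimple.gen R₁ t)
  have hτ : ∀ r, ((τ r : R₁⟮t⟯) : R) = aeval t r := by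
    intro r
    have := aeval_algebraMap_apply R (AdjoinSimple.gen R₁ t) r
    rw [AdjoinSimple.algebraMap_gen] at this
    exact this.symm
  have hτ0 : Function.Injective τ := by
    rw [injective_iff_map_eq_zero]
    intro r hr
    have h2 := hτ r
    rw [hr] at h2
    exact (transcendental_iff.mp ht) r (by simpa using h2.symm)
  let ψ : Localization M →ₐ[R₁] R₁⟮t⟯ := IsLocalization.liftAlgHom (M := M) (f := τ) (fun y => by
    rw [isUnit_iff_ne_zero]
    exact (map_ne_zero_iff τ hτ0).mpr (nonZeroDivisors.ne_zero (hM' y.2)))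
  let φ₀ : Localization M →ₐ[R₁] R₁ := IsLocalization.liftAlgHom (M := M) (f := aeval c) (fun y => by
    rw [isUnit_iff_ne_zero]
    simpa [coe_aeval_eq_eval] using hM _ y.2)
  have hψ : Function.Injective ψ := by
    rw [injective_iff_map_eq_zero]
    intro x hx
    obtain ⟨a, b, rfl⟩ := IsLocalization.exists_mk'_eq M x
    simp only [ψ, IsLocalization.liftAlgHom_apply, IsLocalization.lift_mk'] at hx
    have : τ a = 0 := by simpa using hx
    rw [(map_eq_zero_iff τ hτ0).mp this]; simp
  let e := AlgEquiv.ofInjective ψ hψ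
  refine ⟨ψ.range, φ₀.comp e.symm.toAlgHom, fun u hu => ?_⟩
  have hqc := hc (q u) (by simp; left; exact ⟨u, u.2, hu, rfl⟩) (hq0 u)
  have hqM : q u ∈ M := mem_nonZeroDivisors_of_ne_zero hqc.1
  let x : Localization M := IsLocalization.mk' _ (p u) ⟨q u, hqM⟩
  have hx : ψ x = u := by
    simp only [ψ, x, IsLocalization.liftAlgHom_apply]
    rw [IsLocalization.lift_mk'_spec]
    apply Subtype.ext
    have := hpq u
    simp [hτ]
    rw [mul_comm]; exact this.symm
  refine ⟨⟨x, hx⟩, fun hpos => ?_⟩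
  have he : e.symm ⟨u, ⟨x, hx⟩⟩ = x := by
    rw [AlgEquiv.symm_apply_eq]
    exact Subtype.ext hx.symm
  have h1 : (φ₀.comp e.symm.toAlgHom) ⟨u, ⟨x, hx⟩⟩ = φ₀ x := congrArg φ₀ he
  rw [h1]
  have h2 : φ₀ x * (q u).eval c = (p u).eval c := by
    have : φ₀ x * φ₀ (algebraMap _ _ (q u)) = φ₀ (algebraMap _ _ (p u)) := by
      rw [← map_mul]; congr 1; exact IsLocalization.mk'_spec _ _ _
    simpa [φ₀, coe_aeval_eq_eval] using this
  have h3 : 0 < aeval t (p u * q u) := by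
    rw [map_mul, ← hpq u]
    have := hq u
    have : 0 < (aeval t (q u)) ^ 2 := by positivity
    nlinarith
  have h4 := (hc (p u * q u) (by simp; right; exact ⟨u, u.2, hu, rfl⟩) (by
    intro h; rw [h] at h3; simp at h3)).2 h3
  rw [eval_mul, ← h2] at h4
  have h5 : 0 < ((q u).eval c) ^ 2 := by have := hqc.1; positivity
  by_contra h6
  push Not at h6
  nlinarith

end curve
end ArtinLang

namespace ArtinLang
open Polynomial

lemma range_lift {k A S T : Type*} [CommRing k] [CommRing A] [CommRing S] [CommRing T]
    [Algebra k A] [Algebra k S] [Algebra k T] (g : A →ₐ[k] S) (h : A →ₐ[k] T)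
    (hk : ∀ a, g a = 0 → h a = 0) : Nonempty (g.range →ₐ[k] T) := by
  let e := Ideal.quotientKerAlgEquivOfSurjective g.rangeRestrict_surjective
  refine ⟨(Ideal.Quotient.liftₐ (RingHom.ker g.rangeRestrict) h ?_).comp e.symm.toAlgHom⟩
  intro a ha
  exact hk a (congrArg Subtype.val (RingHom.mem_ker.mp ha))

lemma prim_elem {F R : Type*} [Field F] [CharZero F] [Field R] [Algebra F R] (T : Set R)
    (hT : T.Finite) (hal : ∀ s ∈ T, IsAlgebraic F s) :
    ∃ α : R, IsIntegral F α ∧ ∀ s ∈ T, ∃ p : F[X], aeval α p = s := by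
  have : Finite T := hT
  have := IntermediateField.finiteDimensional_adjoin (K := F) (S := T)
    (fun x hx => (hal x hx).isIntegral)
  obtain ⟨a, ha⟩ := Field.exists_primitive_element F (IntermediateField.adjoin F T)
  have hai : IsIntegral F a := Algebra.IsIntegral.isIntegral a
  refine ⟨a, hai.map (IntermediateField.val _), fun s hs => ?_⟩
  have h1 : (⟨s, IntermediateField.subset_adjoin F T hs⟩ : IntermediateField.adjoin F T) ∈
      (IntermediateField.adjoin F {a}).toSubalgebra := by rw [ha]; trivial
  rw [IntermediateField.adjoin_simple_toSubalgebra_of_isAlgebraic hai.isAlgebraic,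
    Algebra.adjoin_singleton_eq_range_aeval] at h1
  obtain ⟨p, hp⟩ := h1
  refine ⟨p, ?_⟩
  have := congrArg (IntermediateField.val _) hp
  change (IntermediateField.adjoin F T).val (aeval a p) = s at this
  rw [← aeval_algHom_apply] at this
  exact this

section curve
variable {R₁ R : Type*} [Field R₁] [LinearOrder R₁] [IsStrictOrderedRing R₁] [IsRealClosed R₁]
  [Field R] [LinearOrder R] [IsStrictOrderedRing R] [IsRealClosed R] [Algebra R₁ R]

open IntermediateField in
lemma curve (t : R) (ht : Transcendental R₁ t) (T : Set R) (hT : T.Finite)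
    (hal : ∀ s ∈ T, IsAlgebraic R₁⟮t⟯ s) :
    ∃ B : Subalgebra R₁ R, T ⊆ B ∧ Nonempty (B →ₐ[R₁] R₁) := by
  classical
  obtain ⟨α, hα, hs⟩ := prim_elem (F := R₁⟮t⟯) T hT hal
  choose! ps hps using hs
  set f := minpoly R₁⟮t⟯ α with hf
  set n := f.natDegree with hn
  have hfm : f.Monic := minpoly.monic hα
  obtain ⟨P, Q, d, hQP, hd⟩ := exists_diag (Hm n f) (Hm_symm n f)
  let U : Set R₁⟮t⟯ := (f.coeffs : Set R₁⟮t⟯) ∪ (⋃ s ∈ T, ((ps s).coeffs : Set R₁⟮t⟯)) ∪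
    Set.range (fun ij : Fin n × Fin n => P ij.1 ij.2) ∪ Set.range d
  have hU : U.Finite := by
    refine (((Finset.finite_toSet _).union (hT.biUnion fun s _ => Finset.finite_toSet _)).union
      (Set.finite_range _)).union (Set.finite_range _)
  obtain ⟨B, φ, hB⟩ := specialize t ht U hU
  let ι : B →+* R₁⟮t⟯ := B.val.toRingHom
  have hι : Function.Injective ι := Subtype.val_injective
  have hcoef : ∀ p : R₁⟮t⟯[X], (p.coeffs : Set R₁⟮t⟯) ⊆ U → p ∈ lifts ι := by
    intro p hp
    rw [lifts_iff_coeff_lifts]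
    intro i
    by_cases h0 : p.coeff i = 0
    · rw [h0]; exact ⟨0, map_zero _⟩
    · obtain ⟨h, _⟩ := hB _ (hp (coeff_mem_coeffs h0))
      exact ⟨⟨_, h⟩, rfl⟩
  obtain ⟨g, hg, hgd, hgm⟩ := lifts_and_natDegree_eq_and_monic
    (hcoef f (fun x hx => by left; left; left; exact hx)) hfm
  have hPB : ∀ i j, P i j ∈ B := fun i j => (hB _ (by left; right; exact ⟨(i, j), rfl⟩)).1
  have hdB : ∀ i, d i ∈ B := fun i => (hB _ (by right; exact ⟨i, rfl⟩)).1
  let P' : Matrix (Fin n) (Fin n) B := Matrix.of fun i j => ⟨P i j, hPB i j⟩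
  let d' : Fin n → B := fun i => ⟨d i, hdB i⟩
  have hP' : P'.map ι = P := rfl
  have hd' : P'.transpose * Hm n g * P' = Matrix.diagonal d' := by
    apply Matrix.map_injective hι
    change (P'.transpose * Hm n g * P').map ι = (Matrix.diagonal d').map ι
    rw [Matrix.map_mul, Matrix.map_mul, Hm_map, hg, Matrix.transpose_map, hP', hd,
      Matrix.diagonal_map (map_zero _)]
    rfl
  let j : R₁⟮t⟯ →+* R := algebraMap _ _
  have hA : n < 2 * Fintype.card {i // 0 < j (d i)} := by
    refine claimA (f.map j) (hfm.map j) (by rw [natDegree_map]) ?_ α ?_ (P.map j) (Q.map j) _ ?_ ?_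
    · unfold cr
      apply nodup_roots
      apply Separable.map
      apply Separable.map
      exact (minpoly.irreducible hα).separable
    · rw [IsRoot, eval_map, ← aeval_def]; exact minpoly.aeval _ _
    · rw [← Matrix.map_mul, hQP, Matrix.map_one _ (map_zero _) (map_one _)]
    · rw [← Hm_map, ← Matrix.transpose_map, ← Matrix.map_mul, ← Matrix.map_mul, hd,
      Matrix.diagonal_map (map_zero _)]
  let φ' : B →+* R₁ := φ.toRingHom
  obtain ⟨β, hβ⟩ := claimB (n := n) (g.map φ') (hgm.map _) (by rw [hgm.natDegree_map, hgd])
    (P'.map φ') (fun i => φ' (d' i)) (by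
      rw [← Hm_map, ← Matrix.transpose_map, ← Matrix.map_mul, ← Matrix.map_mul, hd',
        Matrix.diagonal_map (map_zero _)]
      ) (by
      refine hA.trans_le (Nat.mul_le_mul_left 2 ?_)
      refine Fintype.card_subtype_mono _ _ ?_
      intro i hi
      exact (hB (d i) (by right; exact ⟨i, rfl⟩)).2 hi)
  let ι' : B →ₐ[R₁] R := (IntermediateField.val _).comp B.val
  let G : B[X] →ₐ[R₁] R := eval₂AlgHom ι' α (fun _ => Commute.all _ _)
  let H : B[X] →ₐ[R₁] R₁ := eval₂AlgHom φ β (fun _ => Commute.all _ _)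
  have hG : ∀ p : B[X], G p = aeval α (p.map ι) := by
    intro p
    rw [aeval_def, eval₂_map]; rfl
  refine ⟨G.range, ?_, range_lift G H ?_⟩
  · intro s hs
    obtain ⟨q, hq⟩ := (mem_lifts _).mp (hcoef (ps s) (fun x hx => by
      left; left; right; exact Set.mem_biUnion hs hx))
    refine ⟨q, ?_⟩
    change G q = s
    rw [hG, hq, hps s hs]
  · intro p hp
    rw [hG] at hp
    have h1 : p %ₘ g = 0 := by
      apply map_injective ι hι
      rw [map_modByMonic _ hgm, hg, Polynomial.map_zero, modByMonic_eq_zero_iff_dvd hfm]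
      exact minpoly.dvd _ _ hp
    rw [modByMonic_eq_zero_iff_dvd hgm] at h1
    obtain ⟨q, rfl⟩ := h1
    rw [map_mul]
    have : H g = 0 := by
      rw [IsRoot, eval_map] at hβ; exact hβ
    rw [this, zero_mul]
end curve
end ArtinLang

namespace ArtinLang
open Polynomial

lemma realClosed_sub {k R : Type*} [Field k] [Field R] [IsRealClosed R] [Algebra k R]
    (E : IntermediateField k R) (hE : ∀ x : R, IsAlgebraic E x → x ∈ E) : IsRealClosed E where
  one_add_ne_zero {s} hs h := by
    have h1 := sumSq_map (algebraMap E R) hs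
    have h2 := congrArg (algebraMap E R) h
    rw [map_add, map_one, map_zero] at h2
    exact IsSemireal.one_add_ne_zero h1 h2
  isSquare_or_isSquare_neg x := by
    have key : ∀ y : E, IsSquare (y : R) → IsSquare y := by
      rintro y ⟨b, hb⟩
      have : b ∈ E := by
        apply hE
        refine IsAlgebraic.of_pow (n := 2) (by norm_num) ?_
        rw [sq, ← hb]
        exact isAlgebraic_algebraMap y
      exact ⟨⟨b, this⟩, Subtype.ext hb⟩
    rcases IsRealClosed.isSquare_or_isSquare_neg (x : R) with h | h
    · exact Or.inl (key x h)
    · exact Or.inr (key (-x) (by simpa using h))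
  exists_isRoot_of_odd_natDegree {f} hf := by
    obtain ⟨x, hx⟩ := IsRealClosed.exists_isRoot_of_odd_natDegree (f := f.map (algebraMap E R))
      (by rwa [natDegree_map])
    have hf0 : f ≠ 0 := by rintro rfl; simp at hf
    have : x ∈ E := by
      apply hE
      refine ⟨f, hf0, ?_⟩
      rw [IsRoot, eval_map] at hx; exact hx
    refine ⟨⟨x, this⟩, ?_⟩
    have h2 : (f.map (algebraMap E R)).IsRoot (algebraMap E R ⟨x, this⟩) := hx
    exact IsRoot.of_map h2 (algebraMap E R).injective

/-- `T` lies in a subalgebra with a real point. -/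
def Pt {R : Type*} [Field R] [Algebra ℝ R] (T : Set R) : Prop :=
  ∃ B : Subalgebra ℝ R, T ⊆ B ∧ Nonempty (B →ₐ[ℝ] ℝ)

variable {R : Type*} [Field R] [IsRealClosed R] [Algebra ℝ R]

lemma pt_base (T : Set R) (hT : ∀ s ∈ T, IsAlgebraic ℝ s) : Pt T := by
  refine ⟨(algebraicClosure ℝ R).toSubalgebra, fun s hs => mem_algebraicClosure_iff.mpr (hT s hs), ?_⟩
  rcases IsAlgClosed.nonempty_algEquiv_or_of_finrank_eq_two (F := ℝ) (F' := ℂ)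
    (algebraicClosure ℝ R) Complex.finrank_real_complex with ⟨⟨e⟩⟩ | ⟨⟨e⟩⟩
  · exact ⟨e.toAlgHom⟩
  · exfalso
    have h : (e.symm Complex.I : R) * (e.symm Complex.I : R) = -1 := by
      have : e.symm Complex.I * e.symm Complex.I = -1 := by
        rw [← map_mul, Complex.I_mul_I, map_neg, map_one]
      exact congrArg Subtype.val this
    exact IsSemireal.not_isSumSq_neg_one R (h ▸ IsSumSq.mul_self _)

lemma pt_comp (E : IntermediateField ℝ R) (B : Subalgebra E R) (ψ : B →ₐ[E] E) (T : Set R)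
    (hT : T ⊆ B) (h : Pt {x : R | ∃ s : B, (s : R) ∈ T ∧ (ψ s : R) = x}) : Pt T := by
  obtain ⟨B', hB', ⟨θ⟩⟩ := h
  let χ : B.restrictScalars ℝ →ₐ[ℝ] R := E.val.comp (ψ.restrictScalars ℝ)
  let C := B'.comap χ
  let ν : C →ₐ[ℝ] B' := (χ.comp C.val).codRestrict B' (fun x => x.2)
  let e := C.equivMapOfInjective (B.restrictScalars ℝ).val Subtype.val_injective
  refine ⟨C.map (B.restrictScalars ℝ).val, ?_, ⟨(θ.comp ν).comp e.symm.toAlgHom⟩⟩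
  intro s hs
  exact ⟨⟨s, hT hs⟩, hB' ⟨⟨s, hT hs⟩, hs, rfl⟩, rfl⟩

open IntermediateField in
lemma pt_all (S : Finset R) : ∀ T : Set R, T.Finite → (∀ s ∈ T, IsAlgebraic (adjoin ℝ (S : Set R)) s) →
    Pt T := by
  classical
  induction S using Finset.induction_on with
  | empty =>
    intro T _ hT
    apply pt_base
    intro s hs
    have h := hT s hs
    have : Algebra.IsAlgebraic ℝ (adjoin ℝ ((∅ : Finset R) : Set R)) := by
      rw [Finset.coe_empty, adjoin_empty]; infer_instance
    exact h.restrictScalars ℝ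
  | insert x S hx ih =>
    intro T hTf hT
    let F := adjoin ℝ (S : Set R)
    let E' : IntermediateField F R := algebraicClosure F R
    let E : IntermediateField ℝ R := E'.restrictScalars ℝ
    have : Algebra.IsAlgebraic F E' := inferInstance
    have hE : ∀ y : R, IsAlgebraic E y → y ∈ E := by
      intro y hy
      have h1 : IsAlgebraic E' y := hy
      exact mem_algebraicClosure_iff.mpr (h1.restrictScalars F)
    have hrc : IsRealClosed E := realClosed_sub E hE
    have hle : adjoin ℝ ((insert x S : Finset R) : Set R) ≤ (adjoin E {x}).restrictScalars ℝ := by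
      rw [adjoin_le_iff]
      intro y hy
      rw [Finset.coe_insert] at hy
      rcases hy with rfl | hy
      · exact mem_adjoin_simple_self E y
      · have h1 : y ∈ E := by
          change y ∈ E'
          exact E'.algebraMap_mem ⟨y, subset_adjoin ℝ _ hy⟩
        exact (adjoin E {x}).algebraMap_mem ⟨y, h1⟩
    have hT' : ∀ s ∈ T, IsAlgebraic (adjoin E {x}) s := by
      intro s hs
      obtain ⟨p, hp0, hp⟩ := hT s hs
      let inc : adjoin ℝ ((insert x S : Finset R) : Set R) →+* adjoin E {x} :=
        { toFun := fun y => ⟨y, hle y.2⟩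
          map_one' := rfl
          map_mul' := fun _ _ => rfl
          map_zero' := rfl
          map_add' := fun _ _ => rfl }
      refine ⟨p.map inc, ?_, ?_⟩
      · rwa [Ne, Polynomial.map_eq_zero]
      · rw [aeval_def, eval₂_map]; exact hp
    by_cases hxa : IsAlgebraic E x
    · apply ih T hTf
      intro s hs
      have := isAlgebraic_adjoin_simple hxa.isIntegral
      exact mem_algebraicClosure_iff.mp (hE s ((hT' s hs).restrictScalars E))
    · obtain ⟨_, _⟩ := exists_order R
      obtain ⟨_, _⟩ := exists_order E
      obtain ⟨B, hTB, ⟨ψ⟩⟩ := curve (R₁ := E) x hxa T hTf hT'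
      refine pt_comp E B ψ T hTB ?_
      apply ih
      · have : ((fun s : B => (ψ s : R)) '' {s : B | (s : R) ∈ T}).Finite :=
          (hTf.preimage Subtype.val_injective.injOn).image _
        exact this
      · rintro _ ⟨s, hs, rfl⟩
        exact mem_algebraicClosure_iff.mp (show (ψ s : R) ∈ E' from (ψ s).2)

theorem artin_lang (A : Type) [CommRing A] [Algebra ℝ A] [hA : Algebra.FiniteType ℝ A]
    (K : Type) [Field K] (g : A →+* K) (hK : ¬ IsSumSq (-1 : K)) : Nonempty (A →ₐ[ℝ] ℝ) := by
  classical
  obtain ⟨R, _, _, _⟩ := exists_realClosed K hK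
  let g' : A →+* R := (algebraMap K R).comp g
  letI : Algebra ℝ R := (g'.comp (algebraMap ℝ A)).toAlgebra
  let γ : A →ₐ[ℝ] R := { g' with commutes' := fun r => rfl }
  obtain ⟨s, hs⟩ := hA.out
  obtain ⟨B, hB, ⟨θ⟩⟩ := pt_all (s.image γ) (s.image γ : Finset R) (Finset.finite_toSet _)
    (fun x hx => isAlgebraic_algebraMap (⟨x, IntermediateField.subset_adjoin ℝ _ hx⟩ :
      IntermediateField.adjoin ℝ ((s.image γ : Finset R) : Set R)))
  have hr : ∀ a, γ a ∈ B := by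
    have : γ.range ≤ B := by
      rw [← Algebra.map_top, ← hs, AlgHom.map_adjoin, Algebra.adjoin_le_iff]
      simpa using hB
    exact fun a => this ⟨a, rfl⟩
  exact ⟨θ.comp (γ.codRestrict B hr)⟩

end ArtinLang

open AlgebraicGeometry CategoryTheory

namespace ArtinLang

lemma sumSq_real_nonneg {x : ℝ} (h : IsSumSq x) : 0 ≤ x := h.nonneg

lemma exists_section (X : Scheme) (x : X) (a : X.presheaf.stalk x) (ha : IsSumSq a) :
    ∃ (U : X.Opens) (hU : x ∈ U) (s : Γ(X, U)), IsSumSq s ∧ X.presheaf.germ U x hU s = a := by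
  induction ha with
  | zero => exact ⟨⊤, trivial, 0, IsSumSq.zero, map_zero _⟩
  | sq_add b hs ih =>
    obtain ⟨U, hU, s, hs', rfl⟩ := ih
    obtain ⟨V, hV, t, rfl⟩ := X.presheaf.exists_germ_eq b
    have hUV : x ∈ U ⊓ V := ⟨hU, hV⟩
    refine ⟨U ⊓ V, hUV,
      X.presheaf.map (homOfLE inf_le_right).op t * X.presheaf.map (homOfLE inf_le_right).op t
        + X.presheaf.map (homOfLE inf_le_left).op s, ?_, ?_⟩
    · exact IsSumSq.sq_add _ (sumSq_map (X.presheaf.map (homOfLE inf_le_left).op).hom hs')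
    · rw [map_add, map_mul, TopCat.Presheaf.germ_res_apply, TopCat.Presheaf.germ_res_apply]

lemma residue_prime_real (I : Ideal ℝ) [hI : I.IsPrime] :
    ¬ IsSumSq (-1 : I.ResidueField) := by
  intro h2
  have hb : Function.Bijective (algebraMap ℝ I.ResidueField) := by
    refine ⟨(algebraMap ℝ _).injective, ?_⟩
    have : I.IsMaximal := by
      have : I = ⊥ := (Ideal.eq_bot_or_top I).resolve_right hI.ne_top
      rw [this]; exact Ideal.bot_isMaximal
    exact Ideal.algebraMap_residueField_surjective I
  have h3 := sumSq_map (RingEquiv.ofBijective _ hb).symm.toRingHom h2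
  rw [map_neg, map_one] at h3
  have := sumSq_real_nonneg h3
  linarith

lemma residue_spec_real (y : Spec (CommRingCat.of ℝ)) :
    ¬ IsSumSq (-1 : (Spec (CommRingCat.of ℝ)).residueField y) := by
  intro h
  have h2 := sumSq_map (Scheme.Spec.residueFieldIso (CommRingCat.of ℝ) y).hom.hom h
  rw [map_neg, map_one] at h2
  have : Ideal.IsPrime (α := ℝ) y.asIdeal := y.2
  exact residue_prime_real y.asIdeal h2

lemma dense_imp (X : Scheme) [IsIntegral X] (f : X ⟶ Spec (CommRingCat.of ℝ))
    (hd : Dense {x : X | IsIso (f.residueFieldMap x)}) :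
    ¬ IsSumSq (-1 : X.functionField) := by
  intro h
  obtain ⟨U, hU, s, hs, hs1⟩ := exists_section X _ _ h
  have : s = -1 := by
    apply germ_injective_of_isIntegral X _ hU
    rw [hs1, map_neg, map_one]
  subst this
  obtain ⟨x, hxU, hx⟩ := hd.inter_open_nonempty U U.isOpen ⟨_, hU⟩
  have hx : IsIso (f.residueFieldMap x) := hx
  have h2 := sumSq_map (X.evaluation U x hxU ≫ inv (f.residueFieldMap x)).hom hs
  rw [map_neg, map_one] at h2
  exact residue_spec_real _ h2

lemma imp_dense (X : Scheme) [IsIntegral X] (f : X ⟶ Spec (CommRingCat.of ℝ))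
    [LocallyOfFiniteType f] (h : ¬ IsSumSq (-1 : X.functionField)) :
    Dense {x : X | IsIso (f.residueFieldMap x)} := by
  rw [dense_iff_inter_open]
  rintro W hW ⟨w, hw⟩
  obtain ⟨U, hU, hwU, hUW⟩ := exists_isAffineOpen_mem_and_subset (X := X) (x := w) (U := ⟨W, hW⟩) hw
  have : Nonempty U := ⟨⟨w, hwU⟩⟩
  let ψ := Spec.preimage (hU.fromSpec ≫ f)
  have hψ : Spec.map ψ = hU.fromSpec ≫ f := Spec.map_preimage _
  have hft : ψ.hom.FiniteType := by
    have : LocallyOfFiniteType (Spec.map ψ) := by rw [hψ]; infer_instance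
    exact (HasRingHomProperty.Spec_iff (P := @LocallyOfFiniteType)).mp this
  letI : Algebra ℝ Γ(X, U) := ψ.hom.toAlgebra
  have : Algebra.FiniteType ℝ Γ(X, U) := hft
  obtain ⟨φ⟩ := artin_lang Γ(X, U) X.functionField (X.germToFunctionField U).hom h
  let g : Spec (CommRingCat.of ℝ) ⟶ X := Spec.map (CommRingCat.ofHom φ.toRingHom) ≫ hU.fromSpec
  have hg : g ≫ f = 𝟙 _ := by
    simp only [g, Category.assoc, ← hψ, ← Spec.map_comp]
    rw [← Spec.map_id]
    congr 1
    ext x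
    exact φ.commutes x
  let p : Spec (CommRingCat.of ℝ) := Classical.arbitrary _
  refine ⟨g p, hUW ?_, ?_⟩
  · have : hU.fromSpec (Spec.map (CommRingCat.ofHom φ.toRingHom) p) ∈ Set.range hU.fromSpec := ⟨_, rfl⟩
    rw [hU.range_fromSpec] at this
    exact this
  · have hi : IsIso (g ≫ f) := by rw [hg]; infer_instance
    have h1 : IsIso ((g ≫ f).residueFieldMap p) := inferInstance
    have hb := ConcreteCategory.bijective_of_isIso ((g ≫ f).residueFieldMap p)
    rw [Scheme.residueFieldMap_comp] at hb
    have hinj : Function.Injective (g.residueFieldMap p).hom := RingHom.injective _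
    change IsIso (f.residueFieldMap (g p))
    rw [ConcreteCategory.isIso_iff_bijective]
    refine ⟨RingHom.injective _, fun y => ?_⟩
    obtain ⟨z, hz⟩ := hb.2 ((g.residueFieldMap p).hom y)
    exact ⟨z, hinj hz⟩

end ArtinLang

/-- (Proposition 1.3, Artin–Lang.) Let `X` be a nonempty integral scheme locally
of finite type over `Spec ℝ`. Then the function field `ℝ(X)` is formally real
(`-1` is not a sum of squares in `ℝ(X)`) if and only if the set of `ℝ`-rational
points of `X` (those `x` whose residue field is `ℝ`, i.e. such that the induced
map on residue fields is an isomorphism) is dense in `X`. -/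
theorem functionField_formallyReal_iff_dense_rational_points
    (X : Scheme) [IsIntegral X]
    (f : X ⟶ Spec (CommRingCat.of ℝ)) [LocallyOfFiniteType f] :
    (¬ IsSumSq (-1 : X.functionField)) ↔
      Dense {x : X | IsIso (f.residueFieldMap x)} := by
  exact ⟨ArtinLang.imp_dense X f, ArtinLang.dense_imp X f⟩
end

section
/- Let F ∈ ℂ[X₀,X₁,X₂,X₃] be a homogeneous polynomial of degree 6 such that the partial derivatives ∂F/∂X₀,…,∂F/∂X₃ have no common zero in ℂ⁴ ∖ {0} (i.e., the sextic surface {F = 0} ⊂ ℙ³ is smooth). Then there exist linearly independent vectors a, b ∈ ℂ⁴ and a homogeneous binary cubic form h ∈ ℂ[S,T] of degree 3 such that F(s·a + t·b) = h(s,t)² for all s, t ∈ ℂ. (Equivalently, the double cover Y = {Z² + F = 0} of ℙ³ ramified over the smooth sextic contains a line.) -/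
/-- A maximal ideal argument: a finite-type situation has a complex point over `z`. -/
lemma exists_point_of_prime {n : ℕ} (S : Set (MvPolynomial (Fin n) (Polynomial ℂ))) (z : ℂ)
    (q : Ideal (MvPolynomial (Fin n) (Polynomial ℂ))) (hq : q ≠ ⊤) (hS : ∀ p ∈ S, p ∈ q)
    (hz : MvPolynomial.C (Polynomial.X - Polynomial.C z) ∈ q) :
    ∃ x : Fin n → ℂ, ∀ p ∈ S, MvPolynomial.eval₂ (Polynomial.evalRingHom z) x p = 0 := by
  obtain ⟨M, hM, hqM⟩ := Ideal.exists_le_maximal q hq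
  let : Field (MvPolynomial (Fin n) (Polynomial ℂ) ⧸ M) := Ideal.Quotient.field M
  have : Algebra.FiniteType (Polynomial ℂ) (MvPolynomial (Fin n) (Polynomial ℂ)) := inferInstance
  have : Algebra.FiniteType ℂ (MvPolynomial (Fin n) (Polynomial ℂ)) :=
    Algebra.FiniteType.trans (S := Polynomial ℂ) inferInstance inferInstance
  have : Algebra.FiniteType ℂ (MvPolynomial (Fin n) (Polynomial ℂ) ⧸ M) := inferInstance
  have : Module.Finite ℂ (MvPolynomial (Fin n) (Polynomial ℂ) ⧸ M) :=
    finite_of_finite_type_of_isJacobsonRing ℂ _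
  let φ : (MvPolynomial (Fin n) (Polynomial ℂ) ⧸ M) →ₐ[ℂ] ℂ := IsAlgClosed.lift
  let ψ : MvPolynomial (Fin n) (Polynomial ℂ) →+* ℂ :=
    (φ : _ →+* ℂ).comp (Ideal.Quotient.mk M)
  have hψM : ∀ p ∈ M, ψ p = 0 := by
    intro p hp
    simp [ψ, Ideal.Quotient.eq_zero_iff_mem.2 hp]
  have hψC : ψ.comp MvPolynomial.C = Polynomial.evalRingHom z := by
    have hc : ∀ c : ℂ, ψ (MvPolynomial.C (Polynomial.C c)) = c := by
      intro c
      exact φ.commutes c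
    apply Polynomial.ringHom_ext
    · intro c
      simp [hc]
    · have := hψM _ (hqM hz)
      simp only [map_sub, hc] at this
      simpa using sub_eq_zero.1 this
  refine ⟨fun i => ψ (MvPolynomial.X i), fun p hp => ?_⟩
  have : MvPolynomial.eval₂Hom (Polynomial.evalRingHom z) (fun i => ψ (MvPolynomial.X i)) = ψ := by
    apply MvPolynomial.ringHom_ext
    · intro r
      simp only [MvPolynomial.coe_eval₂Hom, MvPolynomial.eval₂_C]
      rw [← hψC]; rfl
    · intro i
      simp
  have h2 := congrArg (fun f => f p) this
  simp only [MvPolynomial.coe_eval₂Hom] at h2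
  rw [h2]
  exact hψM _ (hqM (hS p hp))

/-- The prime ideal of polynomials vanishing at `z`. -/
noncomputable def ptOf (z : ℂ) : PrimeSpectrum (Polynomial ℂ) :=
  PrimeSpectrum.comap (Polynomial.evalRingHom z) ⊥

lemma mem_ptOf (z : ℂ) (p : Polynomial ℂ) : p ∈ (ptOf z).asIdeal ↔ p.eval z = 0 := by
  change Polynomial.evalRingHom z p ∈ (⊥ : Ideal ℂ) ↔ _
  simp

lemma ptOf_mem_range {A : Type*} [CommRing A] (f : Polynomial ℂ →+* A) (z : ℂ) (ψ : A →+* ℂ)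
    (h : ψ.comp f = Polynomial.evalRingHom z) : ptOf z ∈ Set.range (PrimeSpectrum.comap f) := by
  refine ⟨PrimeSpectrum.comap ψ ⊥, ?_⟩
  rw [ptOf, ← h, PrimeSpectrum.comap_comp]
  rfl

/-- Chevalley's theorem over the affine line, in terms of prime spectra. -/
lemma cofinite_range {A : Type*} [CommRing A] (f : Polynomial ℂ →+* A) (hf : f.FinitePresentation)
    (hinf : {z : ℂ | ptOf z ∈ Set.range (PrimeSpectrum.comap f)}.Infinite) :
    ∃ g : Polynomial ℂ, g ≠ 0 ∧ ∀ z : ℂ, g.eval z ≠ 0 →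
      ptOf z ∈ Set.range (PrimeSpectrum.comap f) := by
  obtain ⟨T, hT⟩ := PrimeSpectrum.exists_constructibleSetData_iff.2
    (PrimeSpectrum.isConstructible_range_comap hf)
  rw [← hT] at hinf ⊢
  have hC : ∃ C ∈ T, {z : ℂ | ptOf z ∈ C.toSet}.Infinite := by
    by_contra hcon
    push Not at hcon
    apply hinf
    have : {z : ℂ | ptOf z ∈ T.toSet} = ⋃ C ∈ T, {z : ℂ | ptOf z ∈ C.toSet} := by
      ext z
      simp [PrimeSpectrum.ConstructibleSetData.toSet]
    rw [this]
    exact Set.Finite.biUnion T.finite_toSet (fun C hC => by simpa using hcon C hC)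
  obtain ⟨C, hCT, hCinf⟩ := hC
  have hCmem : ∀ z, ptOf z ∈ C.toSet ↔ (∀ i, (C.g i).eval z = 0) ∧ C.f.eval z ≠ 0 := by
    intro z
    simp only [PrimeSpectrum.BasicConstructibleSetData.toSet, Set.mem_sdiff,
      PrimeSpectrum.mem_zeroLocus, Set.singleton_subset_iff, SetLike.mem_coe, mem_ptOf,
      Set.range_subset_iff]
  refine ⟨C.f, ?_, fun z hz => ?_⟩
  · intro h0
    obtain ⟨z, hz⟩ := hCinf.nonempty
    exact ((hCmem z).1 hz).2 (by simp [h0])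
  · refine Set.mem_biUnion hCT ((hCmem z).2 ⟨fun i => ?_, hz⟩)
    have : C.g i = 0 := Polynomial.eq_zero_of_infinite_isRoot _
      (hCinf.mono fun w hw => ((hCmem w).1 hw).1 i)
    simp [this]

lemma lift_comp_aux {P Q R : Type*} [CommRing P] [CommRing Q] [CommRing R] (I : Ideal P)
    (g : P →+* Q) (hg : ∀ a ∈ I, g a = 0) (j : R →+* P) :
    (Ideal.Quotient.lift I g hg).comp ((Ideal.Quotient.mk I).comp j) = g.comp j := rfl

/-- Chevalley's theorem over the affine line: the set of parameters for which a polynomial system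
is solvable is cofinite as soon as it is infinite. -/
lemma cofinite_of_infinite {n : ℕ} (S : Set (MvPolynomial (Fin n) (Polynomial ℂ)))
    (hinf : {z : ℂ | ∃ x : Fin n → ℂ,
      ∀ p ∈ S, MvPolynomial.eval₂ (Polynomial.evalRingHom z) x p = 0}.Infinite) :
    ∃ f : Polynomial ℂ, f ≠ 0 ∧ ∀ z : ℂ, f.eval z ≠ 0 → ∃ x : Fin n → ℂ,
      ∀ p ∈ S, MvPolynomial.eval₂ (Polynomial.evalRingHom z) x p = 0 := by
  have hft : RingHom.FinitePresentation (A := Polynomial ℂ)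
      (B := MvPolynomial (Fin n) (Polynomial ℂ) ⧸ Ideal.span S)
      ((Ideal.Quotient.mk (Ideal.span S)).comp MvPolynomial.C) := by
    refine RingHom.FinitePresentation.of_finiteType.1 ?_
    refine RingHom.FiniteType.comp_surjective ?_ Ideal.Quotient.mk_surjective
    exact RingHom.finiteType_algebraMap.2
      (inferInstance : Algebra.FiniteType (Polynomial ℂ) (MvPolynomial (Fin n) (Polynomial ℂ)))
  obtain ⟨g, hg, H⟩ := cofinite_range _ hft (by
    refine hinf.mono ?_
    rintro z ⟨x, hx⟩
    have hle : Ideal.span S ≤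
        RingHom.ker (MvPolynomial.eval₂Hom (Polynomial.evalRingHom z) x) :=
      Ideal.span_le.2 (fun p hp => hx p hp)
    refine ptOf_mem_range _ z (Ideal.Quotient.lift (Ideal.span S)
        (MvPolynomial.eval₂Hom (Polynomial.evalRingHom z) x) (fun a ha => RingHom.mem_ker.1 (hle ha))) ?_
    refine (lift_comp_aux _ _ _ _).trans ?_
    apply RingHom.ext
    intro r
    exact MvPolynomial.eval₂_C _ _ _)
  refine ⟨g, hg, fun z hz => ?_⟩
  obtain ⟨q, hq⟩ := H z hz
  refine exists_point_of_prime S z (q.asIdeal.comap (Ideal.Quotient.mk _))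
    (Ideal.comap_ne_top _ q.2.ne_top) ?_ ?_
  · intro p hp
    rw [Ideal.mem_comap, Ideal.Quotient.eq_zero_iff_mem.2 (Ideal.subset_span hp)]
    exact zero_mem _
  · have : (Polynomial.X - Polynomial.C z) ∈ (ptOf z).asIdeal := by
      rw [mem_ptOf]; simp
    rw [← hq] at this
    exact this
open Filter Topology

/-- Binary cubic with given coefficients. -/
def cub (c : Fin 4 → ℂ) (s t : ℂ) : ℂ :=
  c 0 * s ^ 3 + c 1 * (s ^ 2 * t) + c 2 * (s * t ^ 2) + c 3 * t ^ 3

/-- `G` restricted to the span of `a, b` is the square of a cubic. -/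
def SqOn (G : EuclideanSpace ℂ (Fin 4) → ℂ) (a b : EuclideanSpace ℂ (Fin 4)) : Prop :=
  ∃ c : Fin 4 → ℂ, ∀ s t : ℂ, G (s • a + t • b) = cub c s t ^ 2

lemma SqOn.change {G : EuclideanSpace ℂ (Fin 4) → ℂ} {a b : EuclideanSpace ℂ (Fin 4)}
    (h : SqOn G a b) (α β γ : ℂ) : SqOn G (α • a) (β • a + γ • b) := by
  obtain ⟨c, hc⟩ := h
  refine ⟨![c 0 * α ^ 3,
    3 * c 0 * α ^ 2 * β + c 1 * α ^ 2 * γ,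
    3 * c 0 * α * β ^ 2 + 2 * c 1 * α * β * γ + c 2 * α * γ ^ 2,
    c 0 * β ^ 3 + c 1 * β ^ 2 * γ + c 2 * β * γ ^ 2 + c 3 * γ ^ 3], fun s t => ?_⟩
  have : s • α • a + t • (β • a + γ • b) = (s * α + t * β) • a + (t * γ) • b := by
    module
  rw [this, hc]
  congr 1
  simp [cub]
  ring

lemma SqOn.orthonormal {G : EuclideanSpace ℂ (Fin 4) → ℂ} {a b : EuclideanSpace ℂ (Fin 4)}
    (h : SqOn G a b) (hl : LinearIndependent ℂ ![a, b]) :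
    ∃ a' b', SqOn G a' b' ∧ Orthonormal ℂ ![a', b'] := by
  have ha : a ≠ 0 := by simpa using hl.ne_zero 0
  have hna : (‖a‖ : ℂ) ≠ 0 := by simpa using ha
  set μ : ℂ := inner ℂ a b / (‖a‖ : ℂ) ^ 2 with hμ
  set b1 := b - μ • a with hb1
  have hb : b1 ≠ 0 := by
    intro h0
    rw [LinearIndependent.pair_iff] at hl
    have := hl (-μ) 1 (by rw [← h0, hb1]; module)
    simp at this
  have hnb : (‖b1‖ : ℂ) ≠ 0 := by simpa using hb
  have hin : inner ℂ a b1 = 0 := by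
    rw [hb1, inner_sub_right, inner_smul_right, inner_self_eq_norm_sq_to_K, hμ]
    simp only [Complex.coe_algebraMap]
    field_simp
    simp
  refine ⟨(‖a‖ : ℂ)⁻¹ • a, (-(‖b1‖ : ℂ)⁻¹ * μ) • a + (‖b1‖ : ℂ)⁻¹ • b, h.change _ _ _, ?_⟩
  have e : (-(‖b1‖ : ℂ)⁻¹ * μ) • a + (‖b1‖ : ℂ)⁻¹ • b = (‖b1‖ : ℂ)⁻¹ • b1 := by
    rw [hb1]; module
  rw [e]
  rw [orthonormal_iff_ite]
  have hin2 : inner ℂ b1 a = 0 := inner_eq_zero_symm.1 hin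
  intro i j
  fin_cases i <;> fin_cases j <;>
    simp [inner_smul_left, inner_smul_right, hin, hin2, inner_self_eq_norm_sq_to_K]
  · exact Or.inl (norm_smul_inv_norm ha)
  · exact Or.inl (norm_smul_inv_norm hb)

lemma SqOn.limit (G : ℂ × EuclideanSpace ℂ (Fin 4) → ℂ) (hG : Continuous G)
    (z : ℕ → ℂ) (w : ℂ) (hz : Tendsto z atTop (𝓝 w))
    (a b : ℕ → EuclideanSpace ℂ (Fin 4)) (hab : ∀ n, Orthonormal ℂ ![a n, b n])
    (hsq : ∀ n, SqOn (fun x => G (z n, x)) (a n) (b n)) :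
    ∃ a' b', SqOn (fun x => G (w, x)) a' b' ∧ Orthonormal ℂ ![a', b'] := by
  choose c hc using hsq
  have hna : ∀ n, ‖a n‖ = 1 := fun n => (hab n).1 0
  have hnb : ∀ n, ‖b n‖ = 1 := fun n => (hab n).1 1
  have hzb : Bornology.IsBounded (Set.range z) := Metric.isBounded_range_of_tendsto z hz
  obtain ⟨Rz, hRz⟩ := hzb.exists_norm_le
  have hK : IsCompact (Metric.closedBall (0 : ℂ) Rz ×ˢ
      Metric.closedBall (0 : EuclideanSpace ℂ (Fin 4)) 2) :=
    (isCompact_closedBall _ _).prod (isCompact_closedBall _ _)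
  obtain ⟨M, hM⟩ := hK.exists_bound_of_continuousOn hG.continuousOn
  have hcub : ∀ n s t, ‖s‖ ≤ 1 → ‖t‖ ≤ 1 → ‖cub (c n) s t‖ ≤ M + 1 := by
    intro n s t hs ht
    have h1 := hM (z n, s • a n + t • b n) (by
      refine ⟨?_, ?_⟩
      · simpa using hRz _ ⟨n, rfl⟩
      · simp only [mem_closedBall_zero_iff]
        refine (norm_add_le _ _).trans ?_
        rw [norm_smul, norm_smul, hna, hnb]
        linarith)
    have h2 := hc n s t
    simp only at h2
    rw [h2, norm_pow] at h1
    nlinarith [norm_nonneg (cub (c n) s t), sq_nonneg (‖cub (c n) s t‖ - 1)]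
  have hcb : ∀ n, ‖c n‖ ≤ 2 * (M + 1) := by
    intro n
    have h0 := hcub n 1 0 (by simp) (by simp)
    have h3 := hcub n 0 1 (by simp) (by simp)
    have hp := hcub n 1 1 (by simp) (by simp)
    have hm := hcub n 1 (-1) (by simp) (by simp)
    have e0 : c n 0 = cub (c n) 1 0 := by simp [cub]
    have e3 : c n 3 = cub (c n) 0 1 := by simp [cub]
    have e1 : c n 1 = (1 / 2) * (cub (c n) 1 1 - cub (c n) 1 (-1)) - cub (c n) 0 1 := by
      simp [cub]; ring
    have e2 : c n 2 = (1 / 2) * (cub (c n) 1 1 + cub (c n) 1 (-1)) - cub (c n) 1 0 := by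
      simp [cub]; ring
    have hM0 : 0 ≤ M + 1 := (norm_nonneg _).trans h0
    have key : ∀ x y u : ℂ, ‖x‖ ≤ M + 1 → ‖y‖ ≤ M + 1 → ‖u‖ ≤ M + 1 →
        ‖(1 / 2) * (x + y) - u‖ ≤ 2 * (M + 1) := by
      intro x y u hx hy hu
      refine (norm_sub_le _ _).trans ?_
      rw [norm_mul]
      have := norm_add_le x y
      have h12 : ‖(1 / 2 : ℂ)‖ = 1 / 2 := by simp
      rw [h12]
      linarith
    rw [pi_norm_le_iff_of_nonneg (by linarith)]
    intro i
    fin_cases i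
    · change ‖c n 0‖ ≤ _
      rw [e0]; linarith
    · change ‖c n 1‖ ≤ _
      rw [e1, sub_eq_add_neg (cub (c n) 1 1)]
      exact key _ _ _ hp (by simpa using hm) h3
    · change ‖c n 2‖ ≤ _
      rw [e2]
      exact key _ _ _ hp hm h0
    · change ‖c n 3‖ ≤ _
      rw [e3]; linarith
  have hbd : Bornology.IsBounded ((Metric.closedBall (0 : EuclideanSpace ℂ (Fin 4)) 1) ×ˢ
      ((Metric.closedBall (0 : EuclideanSpace ℂ (Fin 4)) 1) ×ˢ
      (Metric.closedBall (0 : Fin 4 → ℂ) (2 * (M + 1))))) :=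
    Metric.isBounded_closedBall.prod (Metric.isBounded_closedBall.prod Metric.isBounded_closedBall)
  obtain ⟨⟨a', b', c'⟩, -, φ, hφ, hlim⟩ := tendsto_subseq_of_bounded hbd
    (x := fun n => (a n, b n, c n)) (fun n => by simp [hna, hnb, hcb])
  have la : Tendsto (fun n => a (φ n)) atTop (𝓝 a') :=
    (continuous_fst.tendsto _).comp hlim
  have lb : Tendsto (fun n => b (φ n)) atTop (𝓝 b') :=
    ((continuous_fst.comp continuous_snd).tendsto _).comp hlim
  have lc : Tendsto (fun n => c (φ n)) atTop (𝓝 c') :=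
    ((continuous_snd.comp continuous_snd).tendsto _).comp hlim
  have lz : Tendsto (fun n => z (φ n)) atTop (𝓝 w) := hz.comp hφ.tendsto_atTop
  refine ⟨a', b', ⟨c', fun s t => ?_⟩, ?_⟩
  · have l1 : Tendsto (fun n => G (z (φ n), s • a (φ n) + t • b (φ n))) atTop
        (𝓝 (G (w, s • a' + t • b'))) :=
      (hG.tendsto _).comp (lz.prodMk_nhds ((la.const_smul s).add (lb.const_smul t)))
    have hcc : Continuous (fun c => cub c s t ^ 2) := by
      unfold cub; fun_prop
    have l2 := (hcc.tendsto c').comp lc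
    refine tendsto_nhds_unique l1 (l2.congr fun n => ?_)
    exact (hc (φ n) s t).symm
  · rw [orthonormal_iff_ite]
    have hij : ∀ i, Tendsto (fun n => (![a (φ n), b (φ n)] : Fin 2 → _) i) atTop
        (𝓝 ((![a', b'] : Fin 2 → _) i)) := by
      intro i
      fin_cases i
      · exact la
      · exact lb
    intro i j
    have l := (hij i).inner (𝕜 := ℂ) (hij j)
    refine tendsto_nhds_unique l (tendsto_const_nhds.congr fun n => ?_)
    exact ((orthonormal_iff_ite.1 (hab (φ n))) i j).symm

/-- The point of the parametrised line with parameter `s`. -/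
def pv {R : Type*} [CommRing R] (x : Fin 7 → R) (s : R) : Fin 4 → R :=
  ![s, 1, x 1 * s + x 0, x 2 * s]

/-- The cubic correction term. -/
def kk {R : Type*} [CommRing R] (x : Fin 7 → R) (s : R) : R :=
  x 3 + x 4 * s + x 5 * s ^ 2 + x 6 * s ^ 3

/-- The defining equations of the incidence variety along the pencil through `F`. -/
noncomputable def EE (F : MvPolynomial (Fin 4) ℂ) {R : Type*} [CommRing R] [Algebra ℂ R]
    (z : R) (x : Fin 7 → R) (s : R) : R :=
  (1 - z) * (s ^ 6 + (x 1 * s + x 0) + x 2 * s * s) + z * MvPolynomial.aeval (pv x s) F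
    - (s ^ 3 - algebraMap ℂ R (1 / 2) * kk x s) ^ 2

lemma EE_map (F : MvPolynomial (Fin 4) ℂ) {R R' : Type*} [CommRing R] [Algebra ℂ R]
    [CommRing R'] [Algebra ℂ R'] (φ : R →ₐ[ℂ] R') (z : R) (x : Fin 7 → R) (s : R) :
    φ (EE F z x s) = EE F (φ z) (fun i => φ (x i)) (φ s) := by
  have h : φ (MvPolynomial.aeval (pv x s) F) =
      MvPolynomial.aeval (pv (fun i => φ (x i)) (φ s)) F := by
    have e := MvPolynomial.comp_aeval_apply (B := R') (pv x s) φ F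
    rw [e]
    congr 2
    funext i
    fin_cases i <;> simp [pv]
  simp only [EE, kk, map_sub, map_add, map_mul, map_pow, map_one, h, AlgHom.commutes]

/-- Seven distinct parameters. -/
def sv (i : Fin 7) : ℂ := ((i : ℕ) : ℂ)

lemma sv_inj : Function.Injective sv := by
  intro i j h
  simp only [sv, Nat.cast_inj] at h
  exact Fin.ext h

lemma EE_eq (F : MvPolynomial (Fin 4) ℂ) (z : ℂ) (x : Fin 7 → ℂ) (s : ℂ) :
    EE F z x s = (∑ j : Fin 7, s ^ (j : ℕ) * x j) - (1 / 4) * (kk x s * kk x s)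
      + z * (MvPolynomial.eval (pv x s) F - (s ^ 6 + (x 1 * s + x 0) + x 2 * s * s)) := by
  simp only [EE, kk, Fin.sum_univ_succ, MvPolynomial.aeval_eq_eval]
  simp
  ring_nf

lemma EE_strict (F : MvPolynomial (Fin 4) ℂ) (s : ℂ) :
    ∃ r : ℂ, HasStrictFDerivAt (fun p : ℂ × (Fin 7 → ℂ) => EE F p.1 p.2 s)
      ((∑ j : Fin 7, s ^ (j : ℕ) •
        ((ContinuousLinearMap.proj j : (Fin 7 → ℂ) →L[ℂ] ℂ).comp
          (ContinuousLinearMap.snd ℂ ℂ (Fin 7 → ℂ))))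
        + r • ContinuousLinearMap.fst ℂ ℂ (Fin 7 → ℂ)) 0 := by
  have hR : ContDiff ℂ 1 (fun p : ℂ × (Fin 7 → ℂ) =>
      MvPolynomial.eval (pv p.2 s) F - (s ^ 6 + (p.2 1 * s + p.2 0) + p.2 2 * s * s)) := by
    have h1 : ContDiff ℂ 1 (fun y : Fin 4 → ℂ => MvPolynomial.eval y F) :=
      (AnalyticOnNhd.eval_mvPolynomial (𝕜 := ℂ) F).contDiff
    have h2 : ContDiff ℂ 1 (fun p : ℂ × (Fin 7 → ℂ) => pv p.2 s) := by
      rw [contDiff_pi]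
      intro i
      fin_cases i <;> simp [pv] <;> fun_prop
    have h3 := h1.comp h2
    refine ContDiff.sub h3 ?_
    fun_prop
  have hk : ContDiff ℂ 1 (fun p : ℂ × (Fin 7 → ℂ) => kk p.2 s) := by
    unfold kk; fun_prop
  have hR' := hR.contDiffAt (x := (0 : ℂ × (Fin 7 → ℂ))).hasStrictFDerivAt one_ne_zero
  have hk' := hk.contDiffAt (x := (0 : ℂ × (Fin 7 → ℂ))).hasStrictFDerivAt one_ne_zero
  have hl : HasStrictFDerivAt (fun p : ℂ × (Fin 7 → ℂ) => ∑ j : Fin 7, s ^ (j : ℕ) * p.2 j)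
      (∑ j : Fin 7, s ^ (j : ℕ) •
        ((ContinuousLinearMap.proj j : (Fin 7 → ℂ) →L[ℂ] ℂ).comp
          (ContinuousLinearMap.snd ℂ ℂ (Fin 7 → ℂ)))) 0 := by
    have := (∑ j : Fin 7, s ^ (j : ℕ) •
        ((ContinuousLinearMap.proj j : (Fin 7 → ℂ) →L[ℂ] ℂ).comp
          (ContinuousLinearMap.snd ℂ ℂ (Fin 7 → ℂ)))).hasStrictFDerivAt (x := 0)
    convert this using 1
    funext p
    simp
  have hz : HasStrictFDerivAt (fun p : ℂ × (Fin 7 → ℂ) => p.1)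
      (ContinuousLinearMap.fst ℂ ℂ (Fin 7 → ℂ)) 0 := hasStrictFDerivAt_fst
  have tot := (hl.sub ((hk'.mul hk').const_mul (1 / 4))).add (hz.mul hR')
  refine ⟨MvPolynomial.eval (pv 0 s) F - s ^ 6, ?_⟩
  have k0 : kk (0 : Fin 7 → ℂ) s = 0 := by simp [kk]
  refine (tot.congr_fderiv ?_).congr_of_eventuallyEq (Eventually.of_forall fun p => ?_)
  · refine ContinuousLinearMap.ext fun p => ?_
    simp [k0]
  · simp only [EE_eq]
    rfl

lemma exists_small (F : MvPolynomial (Fin 4) ℂ) :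
    ∀ᶠ z : ℂ in 𝓝 0, ∃ x : Fin 7 → ℂ, ∀ i, EE F z x (sv i) = 0 := by
  choose r hr using fun i : Fin 7 => EE_strict F (sv i)
  have hpi := hasStrictFDerivAt_pi.2 hr
  have hz : HasStrictFDerivAt (fun p : ℂ × (Fin 7 → ℂ) => p.1)
      (ContinuousLinearMap.fst ℂ ℂ (Fin 7 → ℂ)) 0 := hasStrictFDerivAt_fst
  have hT := hz.prodMk hpi
  have hV : Function.Surjective (Matrix.vandermonde sv).mulVec := by
    rw [Matrix.mulVec_surjective_iff_isUnit, Matrix.isUnit_iff_isUnit_det]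
    exact (Matrix.det_vandermonde_ne_zero_iff.2 sv_inj).isUnit
  have hmap := hT.map_nhds_eq_of_surj (by
    rw [LinearMap.range_eq_top]
    rintro ⟨w, y⟩
    obtain ⟨x, hx⟩ := hV (fun i => y i - r i * w)
    refine ⟨(w, x), ?_⟩
    refine Prod.ext (by simp) ?_
    funext i
    have hi := congrFun hx i
    simp only [Matrix.mulVec, dotProduct, Matrix.vandermonde_apply] at hi
    simp [hi])
  have h0 : ((0 : ℂ × (Fin 7 → ℂ)).1, fun i => EE F (0 : ℂ × (Fin 7 → ℂ)).1
      (0 : ℂ × (Fin 7 → ℂ)).2 (sv i)) = (0 : ℂ × (Fin 7 → ℂ)) := by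
    refine Prod.ext rfl ?_
    funext i
    simp [EE_eq, kk]
  rw [h0] at hmap
  have hrange : Set.range (fun p : ℂ × (Fin 7 → ℂ) => (p.1, fun i => EE F p.1 p.2 (sv i)))
      ∈ 𝓝 (0 : ℂ × (Fin 7 → ℂ)) := by
    rw [← hmap]
    exact range_mem_map
  have hc : Tendsto (fun z : ℂ => ((z, 0) : ℂ × (Fin 7 → ℂ))) (𝓝 0) (𝓝 0) := by
    have : Continuous (fun z : ℂ => ((z, 0) : ℂ × (Fin 7 → ℂ))) := by fun_prop
    exact this.tendsto' _ _ rfl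
  filter_upwards [hc hrange] with z hz
  obtain ⟨⟨w, x⟩, h⟩ := hz
  simp only [Prod.mk.injEq] at h
  obtain ⟨rfl, h2⟩ := h
  exact ⟨x, fun i => congrFun h2 i⟩

lemma eval_scale (H : MvPolynomial (Fin 4) ℂ) (hH : H.IsHomogeneous 6) (t : ℂ) (y : Fin 4 → ℂ) :
    MvPolynomial.eval (fun i => t * y i) H = t ^ 6 * MvPolynomial.eval y H := by
  rw [MvPolynomial.eval_eq', MvPolynomial.eval_eq', Finset.mul_sum]
  refine Finset.sum_congr rfl fun d hd => ?_
  have h6 : ∑ i, d i = 6 := by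
    have := hH (MvPolynomial.mem_support_iff.1 hd)
    rw [← this, Finsupp.weight_apply, Finsupp.sum_fintype _ _ (by simp)]
    simp
  simp only [mul_pow, Finset.prod_mul_distrib, Finset.prod_pow_eq_pow_sum, h6]
  ring

/-- The base sextic. -/
noncomputable def F0 : MvPolynomial (Fin 4) ℂ :=
  MvPolynomial.X 0 ^ 6 + MvPolynomial.X 2 * MvPolynomial.X 1 ^ 5
    + MvPolynomial.X 3 * (MvPolynomial.X 1 ^ 4 * MvPolynomial.X 0)

lemma F0_hom : F0.IsHomogeneous 6 := by
  have hX : ∀ i : Fin 4, (MvPolynomial.X i : MvPolynomial (Fin 4) ℂ).IsHomogeneous 1 :=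
    fun i => MvPolynomial.isHomogeneous_X ℂ i
  refine ((((hX 0).pow 6)).add ?_).add ?_
  · exact (hX 2).mul ((hX 1).pow 5)
  · exact (hX 3).mul (((hX 1).pow 4).mul (hX 0))

/-- A sextic whose restriction is a square at seven parameters is a square on the line. -/
lemma square_of_seven (H : MvPolynomial (Fin 4) ℂ) (hH : H.IsHomogeneous 6) (a b : Fin 4 → ℂ)
    (c : Fin 4 → ℂ)
    (h : ∀ i, MvPolynomial.eval (fun j => sv i * a j + b j) H = cub c (sv i) 1 ^ 2) (s t : ℂ) :
    MvPolynomial.eval (fun j => s * a j + t * b j) H = cub c s t ^ 2 := by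
  let ℓ : Fin 4 → Polynomial ℂ := fun j => Polynomial.X * Polynomial.C (a j) + Polynomial.C (b j)
  let k : Polynomial ℂ := Polynomial.C (c 0) * Polynomial.X ^ 3
    + Polynomial.C (c 1) * Polynomial.X ^ 2 + Polynomial.C (c 2) * Polynomial.X
    + Polynomial.C (c 3)
  let P : Polynomial ℂ := MvPolynomial.aeval ℓ H - k ^ 2
  have hPe : ∀ s, P.eval s = MvPolynomial.eval (fun j => s * a j + b j) H - cub c s 1 ^ 2 := by
    intro s
    have e1 : (MvPolynomial.aeval ℓ H).eval s = MvPolynomial.eval (fun j => s * a j + b j) H := by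
      have := MvPolynomial.comp_aeval_apply (B := ℂ) ℓ (Polynomial.aeval s) H
      rw [Polynomial.coe_aeval_eq_eval] at this
      rw [this, MvPolynomial.aeval_eq_eval]
      congr 2
      funext j
      simp [ℓ, mul_comm s]
    have e2 : k.eval s = cub c s 1 := by simp [k, cub]
    simp only [P, Polynomial.eval_sub, Polynomial.eval_pow, e1, e2]
  have hdeg : P.natDegree ≤ 6 := by
    refine (Polynomial.natDegree_sub_le _ _).trans (max_le ?_ ?_)
    · refine (MvPolynomial.aeval_natDegree_le (m := 6) (n := 1) H hH.totalDegree_le ℓ ?_)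
      intro i
      simp only [ℓ]
      compute_degree
    · have : k.natDegree ≤ 3 := by
        simp only [k]
        compute_degree
      exact (Polynomial.natDegree_pow_le).trans (by omega)
  have hP : P = 0 := Polynomial.eq_zero_of_natDegree_lt_card_of_eval_eq_zero P sv_inj
    (fun i => by rw [hPe, h, sub_self]) (by simpa using Nat.lt_succ_of_le hdeg)
  have h1 : ∀ s, MvPolynomial.eval (fun j => s * a j + b j) H = cub c s 1 ^ 2 := by
    intro s
    have := hPe s
    rw [hP, Polynomial.eval_zero] at this
    exact sub_eq_zero.1 this.symm
  have hne : ∀ t : ℂ, t ≠ 0 →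
      MvPolynomial.eval (fun j => s * a j + t * b j) H = cub c s t ^ 2 := by
    intro t ht
    have e : (fun j => s * a j + t * b j) = fun j => t * ((s / t) * a j + b j) := by
      funext j
      field_simp
    rw [e, eval_scale H hH, h1]
    simp only [cub]
    field_simp
  have hc1 : Continuous fun t : ℂ => MvPolynomial.eval (fun j => s * a j + t * b j) H :=
    (MvPolynomial.continuous_eval H).comp (by fun_prop)
  have hc2 : Continuous fun t : ℂ => cub c s t ^ 2 := by
    unfold cub; fun_prop
  exact congrFun (hc1.ext_on (dense_compl_singleton (0 : ℂ)) hc2 (fun t ht => hne t ht)) t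

/-- A solution of the seven equations yields a line. -/
lemma SqOn_of_EE (F : MvPolynomial (Fin 4) ℂ) (hF : F.IsHomogeneous 6) (z : ℂ) (x : Fin 7 → ℂ)
    (h : ∀ i, EE F z x (sv i) = 0) :
    ∃ a b : EuclideanSpace ℂ (Fin 4), LinearIndependent ℂ ![a, b] ∧
      SqOn (fun y => (1 - z) * MvPolynomial.eval (fun i => y i) F0
        + z * MvPolynomial.eval (fun i => y i) F) a b := by
  refine ⟨!₂[1, 0, x 1, x 2], !₂[0, 1, x 0, 0], ?_, ?_⟩
  · rw [LinearIndependent.pair_iff]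
    intro s t hst
    have h0 := congrArg (fun v : EuclideanSpace ℂ (Fin 4) => v 0) hst
    have h1 := congrArg (fun v : EuclideanSpace ℂ (Fin 4) => v 1) hst
    simp at h0 h1
    exact ⟨h0, h1⟩
  · refine ⟨![1 - x 6 / 2, - x 5 / 2, - x 4 / 2, - x 3 / 2], fun s t => ?_⟩
    have hH : (MvPolynomial.C (1 - z) * F0 + MvPolynomial.C z * F).IsHomogeneous 6 :=
      (F0_hom.C_mul _).add (hF.C_mul _)
    have := square_of_seven _ hH ![1, 0, x 1, x 2] ![0, 1, x 0, 0]
      ![1 - x 6 / 2, - x 5 / 2, - x 4 / 2, - x 3 / 2] (fun i => by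
        have hi := h i
        have e : (fun j => sv i * (![1, 0, x 1, x 2] : Fin 4 → ℂ) j
            + (![0, 1, x 0, 0] : Fin 4 → ℂ) j) = pv x (sv i) := by
          funext j
          fin_cases j <;> simp [pv] <;> ring
        rw [e]
        simp only [EE, MvPolynomial.aeval_eq_eval, sub_eq_zero] at hi
        simp only [map_add, map_mul, MvPolynomial.eval_C]
        have e0 : MvPolynomial.eval (pv x (sv i)) F0 =
            sv i ^ 6 + (x 1 * sv i + x 0) + x 2 * sv i * sv i := by
          simp [F0, pv]
          try ring
        rw [e0]
        refine hi.trans ?_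
        simp [cub, kk]
        ring) s t
    simp only [map_add, map_mul, MvPolynomial.eval_C] at this
    rw [← this]
    have e : (fun i => (s • (!₂[1, 0, x 1, x 2] : EuclideanSpace ℂ (Fin 4))
        + t • (!₂[0, 1, x 0, 0] : EuclideanSpace ℂ (Fin 4))) i) =
        fun j => s * (![1, 0, x 1, x 2] : Fin 4 → ℂ) j + t * (![0, 1, x 0, 0] : Fin 4 → ℂ) j := by
      funext j
      simp
    beta_reduce
    rw [e]

/-- For all but finitely many members of the pencil there is a solution. -/
lemma exists_generic (F : MvPolynomial (Fin 4) ℂ) :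
    ∃ f : Polynomial ℂ, f ≠ 0 ∧ ∀ z : ℂ, f.eval z ≠ 0 →
      ∃ x : Fin 7 → ℂ, ∀ i, EE F z x (sv i) = 0 := by
  let S : Set (MvPolynomial (Fin 7) (Polynomial ℂ)) := Set.range fun i : Fin 7 =>
    EE F (MvPolynomial.C Polynomial.X) MvPolynomial.X
      (algebraMap ℂ (MvPolynomial (Fin 7) (Polynomial ℂ)) (sv i))
  have key : ∀ (z : ℂ) (x : Fin 7 → ℂ),
      (∀ p ∈ S, MvPolynomial.eval₂ (Polynomial.evalRingHom z) x p = 0) ↔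
        ∀ i, EE F z x (sv i) = 0 := by
    intro z x
    let φ : MvPolynomial (Fin 7) (Polynomial ℂ) →ₐ[ℂ] ℂ :=
      { MvPolynomial.eval₂Hom (Polynomial.evalRingHom z) x with
        commutes' := fun c => by
          change MvPolynomial.eval₂ (Polynomial.evalRingHom z) x
            (MvPolynomial.C (Polynomial.C c)) = c
          simp }
    have hφ : ∀ p, φ p = MvPolynomial.eval₂ (Polynomial.evalRingHom z) x p := fun p => rfl
    simp only [S, Set.forall_mem_range]
    refine forall_congr' fun i => ?_
    rw [← hφ, EE_map, AlgHom.commutes]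
    have e1 : φ (MvPolynomial.C Polynomial.X) = z := by rw [hφ]; simp
    have e2 : (fun j => φ (MvPolynomial.X j)) = x := by
      funext j; rw [hφ]; simp
    rw [e1, e2]
    rfl
  simp only [← key]
  apply cofinite_of_infinite
  simp only [key]
  exact infinite_of_mem_nhds 0 (exists_small F)


/-- (Lemma 5.2 for `n = 3`.) A double cover of `ℙ³` ramified over a smooth sextic
surface contains a line: if `F ∈ ℂ[X₀,…,X₃]` is homogeneous of degree `6` and its
partial derivatives have no common zero in `ℂ⁴ ∖ {0}`, then there exist linearly
independent `a, b ∈ ℂ⁴` and a binary cubic form `h` with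
`F(s·a + t·b) = h(s,t)²` for all `s, t ∈ ℂ`. -/
theorem smooth_sextic_double_solid_contains_line
    (F : MvPolynomial (Fin 4) ℂ)
    (hFhom : F.IsHomogeneous 6)
    (hFsmooth : ∀ x : Fin 4 → ℂ, x ≠ 0 →
      ∃ i : Fin 4, MvPolynomial.eval x (MvPolynomial.pderiv i F) ≠ 0) :
    ∃ (a b : Fin 4 → ℂ) (h : MvPolynomial (Fin 2) ℂ),
      LinearIndependent ℂ ![a, b] ∧
      h.IsHomogeneous 3 ∧
      ∀ s t : ℂ,
        MvPolynomial.eval (fun i => s * a i + t * b i) F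
          = (MvPolynomial.eval ![s, t] h) ^ 2 := by
  obtain ⟨f, hf, H⟩ := exists_generic F
  have hdense : Dense {z : ℂ | f.eval z ≠ 0} := by
    have hfin : {z : ℂ | f.eval z = 0}.Finite := by
      refine (f.roots.toFinset.finite_toSet).subset fun z hz => ?_
      simpa [hf] using hz
    exact hfin.countable.dense_compl ℂ
  obtain ⟨z, hz, hlim⟩ := mem_closure_iff_seq_limit.1 (hdense (1 : ℂ))
  have hline : ∀ n, ∃ a b : EuclideanSpace ℂ (Fin 4),
      SqOn (fun y => (1 - z n) * MvPolynomial.eval (fun i => y i) F0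
        + z n * MvPolynomial.eval (fun i => y i) F) a b ∧ Orthonormal ℂ ![a, b] := by
    intro n
    obtain ⟨x, hx⟩ := H (z n) (hz n)
    obtain ⟨a, b, hl, hs⟩ := SqOn_of_EE F hFhom (z n) x hx
    exact hs.orthonormal hl
  choose a b hs hab using hline
  have hev : ∀ p : MvPolynomial (Fin 4) ℂ, Continuous
      (fun q : ℂ × EuclideanSpace ℂ (Fin 4) => MvPolynomial.eval (fun i => q.2 i) p) := by
    intro p
    exact (MvPolynomial.continuous_eval p).comp (by fun_prop)
  obtain ⟨a', b', ⟨c, hc⟩, hor⟩ := SqOn.limit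
    (fun q => (1 - q.1) * MvPolynomial.eval (fun i => q.2 i) F0
        + q.1 * MvPolynomial.eval (fun i => q.2 i) F)
    (((continuous_const.sub continuous_fst).mul (hev F0)).add (continuous_fst.mul (hev F)))
    z 1 hlim a b hab hs
  have hX : ∀ i : Fin 2, (MvPolynomial.X i : MvPolynomial (Fin 2) ℂ).IsHomogeneous 1 :=
    fun i => MvPolynomial.isHomogeneous_X ℂ i
  refine ⟨fun i => a' i, fun i => b' i,
    MvPolynomial.C (c 0) * MvPolynomial.X 0 ^ 3
      + MvPolynomial.C (c 1) * (MvPolynomial.X 0 ^ 2 * MvPolynomial.X 1)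
      + MvPolynomial.C (c 2) * (MvPolynomial.X 0 * MvPolynomial.X 1 ^ 2)
      + MvPolynomial.C (c 3) * MvPolynomial.X 1 ^ 3, ?_, ?_, ?_⟩
  · have hl := hor.linearIndependent
    rw [LinearIndependent.pair_iff] at hl ⊢
    intro s t hst
    refine hl s t ?_
    ext i
    simpa using congrFun hst i
  · refine (((((hX 0).pow 3).C_mul _).add ?_).add ?_).add (((hX 1).pow 3).C_mul _)
    · exact (((hX 0).pow 2).mul (hX 1)).C_mul _
    · exact ((hX 0).mul ((hX 1).pow 2)).C_mul _
  · intro s t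
    have := hc s t
    simpa [cub] using this
end
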